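/- arXiv:1207.3604 — 10 statements merged into one kernel-verified Lean document; each statement's English description precedes it below -/
import Mathlib

section
/- Let F be a finite family of finite subsets of a type α. Then F satisfies the Frankl condition if and only if there exists a function w : α → ℕ that is a weight function on ⋃F and satisfies 2 · fw(w,F) ≥ sw(w,⋃F) · |F|. -/
open Finset

variable {α : Type*} [DecidableEq α]

/-- The union of all members of a family. -/
def famUnion (F : Finset (Finset α)) : Finset α := F.sup id

/-- A family is union-closed. -/
def unionClosed (F : Finset (Finset α)) : Prop :=
  ∀ A ∈ F, ∀ B ∈ F, A ∪ B ∈ F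

/-- A family `F` is union-closed for a family `Fc`. -/
def unionClosedFor (F Fc : Finset (Finset α)) : Prop :=
  unionClosed F ∧ ∀ A ∈ F, ∀ B ∈ Fc, A ∪ B ∈ F

/-- The closure of a family: all unions of nonempty subfamilies. -/
def ucClosure (F : Finset (Finset α)) : Finset (Finset α) :=
  (F.powerset.filter (fun G => G ≠ ∅)).image (fun G => G.sup id)

/-- The number of members of `F` containing `a`. -/
def cnt (a : α) (F : Finset (Finset α)) : ℕ := (F.filter (fun A => a ∈ A)).card

/-- The Frankl condition. -/
def frankl (F : Finset (Finset α)) : Prop :=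
  ∃ a ∈ famUnion F, 2 * cnt a F ≥ F.card

/-- `w` is a weight function on `X`. -/
def weightFunOn (w : α → ℕ) (X : Finset α) : Prop := ∃ a ∈ X, w a > 0

/-- The weight of a set. -/
def sw (w : α → ℕ) (A : Finset α) : ℕ := ∑ a ∈ A, w a

/-- The weight of a family. -/
def fw (w : α → ℕ) (F : Finset (Finset α)) : ℕ := ∑ A ∈ F, sw w A

/-- The share of a set w.r.t. `w` and `X` (an integer). -/
def ss (w : α → ℕ) (A X : Finset α) : ℤ := 2 * (sw w A : ℤ) - (sw w X : ℤ)

/-- The share of a family w.r.t. `w` and `X`. -/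
def fs (w : α → ℕ) (F : Finset (Finset α)) (X : Finset α) : ℤ := ∑ A ∈ F, ss w A X

/-- The `S`-hypercube with base `K`: sets sandwiched between `K` and `K ∪ S`. -/
def hc (K S : Finset α) : Finset (Finset α) :=
  (K ∪ S).powerset.filter (fun A => K ⊆ A)

/-- The hyper-share of a family. -/
def hs (K S : Finset α) (F : Finset (Finset α)) (w : α → ℕ) (X : Finset α) : ℤ :=
  ∑ A ∈ hc K S ∩ F, ss w A X

/-- The projection of a family onto a hypercube. -/
def hcprj (K S : Finset α) (F : Finset (Finset α)) : Finset (Finset α) :=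
  (hc K S ∩ F).image (fun A => A \ K)

/-- Union-closed extensions of `Fc`. -/
def uce (Fc F' : Finset (Finset α)) : Prop :=
  (∀ A ∈ F', A ⊆ famUnion Fc) ∧ unionClosedFor F' Fc

theorem fw_eq_sum_cnt (w : α → ℕ) (F : Finset (Finset α)) :
    fw w F = ∑ a ∈ famUnion F, w a * cnt a F := by
  have h1 : ∀ A ∈ F, sw w A = ∑ a ∈ famUnion F, if a ∈ A then w a else 0 := by
    intro A hA
    have hs : A ⊆ famUnion F := Finset.le_sup (f := id) hA
    rw [← Finset.sum_filter, Finset.filter_mem_eq_inter, Finset.inter_eq_right.mpr hs, sw]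
  rw [fw, Finset.sum_congr rfl h1, Finset.sum_comm]
  refine Finset.sum_congr rfl fun a _ => ?_
  rw [← Finset.sum_filter, Finset.sum_const, smul_eq_mul, mul_comm, cnt]

theorem frankl_iff_weight {α : Type*} [DecidableEq α] (F : Finset (Finset α)) :
    frankl F ↔ ∃ w : α → ℕ, weightFunOn w (famUnion F) ∧
      2 * fw w F ≥ sw w (famUnion F) * F.card := by
  constructor
  · rintro ⟨a, ha, h⟩
    refine ⟨fun b => if b = a then 1 else 0, ⟨a, ha, by simp⟩, ?_⟩
    rw [fw_eq_sum_cnt]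
    simpa [sw, ha] using h
  · rintro ⟨w, ⟨a, ha, hw⟩, h⟩
    by_contra hc
    have hc' : ∀ b ∈ famUnion F, 2 * cnt b F < F.card := by
      intro b hb
      by_contra h'
      exact hc ⟨b, hb, not_lt.mp h'⟩
    rw [fw_eq_sum_cnt, sw, Finset.sum_mul, Finset.mul_sum] at h
    refine absurd h (not_le.mpr ?_)
    refine Finset.sum_lt_sum (fun b hb => ?_) ⟨a, ha, ?_⟩
    · nlinarith [hc' b hb, Nat.zero_le (w b)]
    · nlinarith [hc' a ha]
end

section
/- Let F be a finite family of finite subsets of a type α. Then F satisfies the Frankl condition if and only if there exists w : α → ℕ that is a weight function on ⋃F and satisfies fs(F,w,⋃F) ≥ 0. -/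
open Finset

variable {α : Type*} [DecidableEq α]

theorem fs_eq_sum_cnt {α : Type*} [DecidableEq α] (w : α → ℕ) (F : Finset (Finset α)) :
    fs w F (famUnion F) =
      ∑ a ∈ famUnion F, (w a : ℤ) * (2 * (cnt a F : ℤ) - (F.card : ℤ)) := by
  have h1 : ∀ A ∈ F, ss w A (famUnion F) =
      ∑ a ∈ famUnion F, (2 * (if a ∈ A then (w a : ℤ) else 0) - (w a : ℤ)) := by
    intro A hA
    have hsub : A ⊆ famUnion F := Finset.le_sup (f := id) hA
    have h2 : (sw w A : ℤ) = ∑ a ∈ famUnion F, (if a ∈ A then (w a : ℤ) else 0) := by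
      rw [← Finset.sum_filter, Finset.filter_mem_eq_inter,
        Finset.inter_eq_right.mpr hsub]
      simp [sw]
    rw [Finset.sum_sub_distrib, ← Finset.mul_sum, ← h2]
    simp [ss, sw]
  unfold fs
  rw [Finset.sum_congr rfl h1, Finset.sum_comm]
  refine Finset.sum_congr rfl fun a _ => ?_
  rw [Finset.sum_sub_distrib, ← Finset.mul_sum, ← Finset.sum_filter]
  simp only [Finset.sum_const, nsmul_eq_mul, cnt]
  ring

theorem frankl_iff_share_nonneg {α : Type*} [DecidableEq α] (F : Finset (Finset α)) :
    frankl F ↔ ∃ w : α → ℕ, weightFunOn w (famUnion F) ∧ fs w F (famUnion F) ≥ 0 := by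
  constructor
  · rintro ⟨a, ha, h⟩
    refine ⟨fun b => if b = a then 1 else 0, ⟨a, ha, by simp⟩, ?_⟩
    rw [fs_eq_sum_cnt]
    refine Finset.sum_nonneg fun b _ => ?_
    by_cases hb : b = a
    · subst hb
      simp only [if_true]
      push_cast
      omega
    · simp [hb]
  · rintro ⟨w, ⟨a, ha, hw⟩, h⟩
    by_contra hF
    have hlt : ∀ b ∈ famUnion F, 2 * (cnt b F : ℤ) - (F.card : ℤ) < 0 := by
      intro b hb
      by_contra hc
      exact hF ⟨b, hb, by omega⟩
    rw [fs_eq_sum_cnt] at h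
    refine absurd h (not_le.mpr (Finset.sum_neg' ?_ ⟨a, ha, ?_⟩))
    · intro b hb
      exact mul_nonpos_of_nonneg_of_nonpos (by positivity) (hlt b hb).le
    · exact mul_neg_of_pos_of_neg (by exact_mod_cast hw) (hlt a ha)
end

section
/- Let F be a finite family of finite subsets of a type α and let w : α → ℕ be a weight function on ⋃F. Let K and S be finite sets with K ∪ S = ⋃F and K ∩ S = ∅. If for every K' ⊆ K the hyper-share hs(K',S,F,w,⋃F) is nonnegative, then F satisfies the Frankl condition. -/
open Finset

variable {α : Type*} [DecidableEq α]

theorem frankl_of_hyper_shares_nonneg {α : Type*} [DecidableEq α] (F : Finset (Finset α))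
    (w : α → ℕ) (hw : weightFunOn w (famUnion F)) (K S : Finset α)
    (hKS : K ∪ S = famUnion F) (hdisj : K ∩ S = ∅)
    (h : ∀ K' ⊆ K, hs K' S F w (famUnion F) ≥ 0) :
    frankl F := by
  have hsub : ∀ A ∈ F, A ⊆ famUnion F := fun A hA => Finset.le_sup (f := id) hA
  -- total share is nonnegative
  have h1 : ∑ A ∈ F, ss w A (famUnion F) = ∑ K' ∈ K.powerset, hs K' S F w (famUnion F) := by
    rw [← Finset.sum_fiberwise_of_maps_to (s := F) (t := K.powerset) (g := fun A => A ∩ K)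
      (fun A _ => by simp)]
    refine Finset.sum_congr rfl fun K' hK' => ?_
    unfold hs
    refine Finset.sum_congr ?_ fun _ _ => rfl
    ext A
    have hK'' : K' ⊆ K := by simpa using hK'
    simp only [hc, mem_filter, mem_inter, mem_powerset]
    constructor
    · rintro ⟨hA, rfl⟩
      refine ⟨⟨fun x hx => ?_, inter_subset_left⟩, hA⟩
      have := hsub A hA hx
      rw [← hKS] at this
      simp only [mem_union, mem_inter] at this ⊢
      tauto
    · rintro ⟨⟨hA1, hA2⟩, hA⟩
      refine ⟨hA, ?_⟩
      ext x
      simp only [mem_inter]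
      constructor
      · rintro ⟨hx, hxK⟩
        rcases mem_union.1 (hA1 hx) with h' | h'
        · exact h'
        · have : x ∈ K ∩ S := mem_inter.2 ⟨hxK, h'⟩
          simp [hdisj] at this
      · exact fun hx => ⟨hA2 hx, hK'' hx⟩
  have h2 : 0 ≤ ∑ A ∈ F, ss w A (famUnion F) := by
    rw [h1]
    exact Finset.sum_nonneg fun K' hK' => h K' (by simpa using hK')
  -- double counting
  have h3 : ∑ A ∈ F, ss w A (famUnion F)
      = ∑ a ∈ famUnion F, (w a : ℤ) * (2 * (cnt a F : ℤ) - (F.card : ℤ)) := by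
    have e : ∀ A ∈ F, ss w A (famUnion F)
        = ∑ a ∈ famUnion F, (w a : ℤ) * (2 * (if a ∈ A then 1 else 0) - 1) := by
      intro A hA
      have e1 : (∑ a ∈ A, (w a : ℤ)) = ∑ a ∈ famUnion F, (if a ∈ A then (w a : ℤ) else 0) := by
        rw [← Finset.sum_filter, Finset.filter_mem_eq_inter,
          Finset.inter_eq_right.2 (hsub A hA)]
      unfold ss sw
      push_cast
      rw [e1, Finset.mul_sum, ← Finset.sum_sub_distrib]
      refine Finset.sum_congr rfl fun a _ => ?_
      split_ifs <;> ring
    rw [Finset.sum_congr rfl e, Finset.sum_comm]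
    refine Finset.sum_congr rfl fun a _ => ?_
    rw [← Finset.mul_sum, Finset.sum_sub_distrib, ← Finset.mul_sum]
    simp [cnt]
  by_contra hF
  have hF' : ∀ a ∈ famUnion F, 2 * (cnt a F : ℤ) - (F.card : ℤ) < 0 := by
    intro a ha
    by_contra hc
    exact hF ⟨a, ha, by omega⟩
  obtain ⟨b, hb, hwb⟩ := hw
  have h4 : ∑ a ∈ famUnion F, (w a : ℤ) * (2 * (cnt a F : ℤ) - (F.card : ℤ)) < 0 := by
    refine Finset.sum_neg' (fun a ha => ?_) ⟨b, hb, ?_⟩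
    · exact mul_nonpos_of_nonneg_of_nonpos (by positivity) (hF' a ha).le
    · exact mul_neg_of_pos_of_neg (by exact_mod_cast hwb) (hF' b hb)
  omega
end

section
/- Let F and F_c be finite families of finite subsets of a type α and let K, S be finite sets. (i) If F is union-closed, then the projection hcprj(K,S,F) is union-closed. (ii) If moreover F_c ⊆ F, S = ⋃F_c, and K ∩ S = ∅, then hcprj(K,S,F) is union-closed for F_c. -/
open Finset

variable {α : Type*} [DecidableEq α]

theorem hcprj_union_closed {α : Type*} [DecidableEq α] (F Fc : Finset (Finset α))
    (K S : Finset α) :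
    (unionClosed F → unionClosed (hcprj K S F)) ∧
    (unionClosed F → Fc ⊆ F → S = famUnion Fc → K ∩ S = ∅ →
      unionClosedFor (hcprj K S F) Fc) := by
  have hmem : ∀ X, X ∈ hcprj K S F ↔ ∃ A, ((A ⊆ K ∪ S ∧ K ⊆ A) ∧ A ∈ F) ∧ A \ K = X := by
    intro X
    simp only [hcprj, hc, Finset.mem_image, Finset.mem_inter, Finset.mem_filter,
      Finset.mem_powerset]
  have h1 : unionClosed F → unionClosed (hcprj K S F) := by
    intro hF X hX Y hY
    rw [hmem] at hX hY ⊢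
    obtain ⟨A, ⟨⟨hA1, hA2⟩, hA3⟩, rfl⟩ := hX
    obtain ⟨B, ⟨⟨hB1, hB2⟩, hB3⟩, rfl⟩ := hY
    exact ⟨A ∪ B, ⟨⟨Finset.union_subset hA1 hB1, hA2.trans Finset.subset_union_left⟩,
      hF A hA3 B hB3⟩, Finset.union_sdiff_distrib A B K⟩
  refine ⟨h1, fun hF hc hS hK => ⟨h1 hF, ?_⟩⟩
  intro X hX B hB
  rw [hmem] at hX ⊢
  obtain ⟨A, ⟨⟨hA1, hA2⟩, hA3⟩, rfl⟩ := hX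
  have hBS : B ⊆ S := by
    rw [hS]
    exact Finset.le_sup (f := id) hB
  have hd : B \ K = B := by
    apply Finset.sdiff_eq_self_of_disjoint
    exact (Finset.disjoint_iff_inter_eq_empty.mpr hK).symm.mono_left hBS
  refine ⟨A ∪ B, ⟨⟨Finset.union_subset hA1 (hBS.trans Finset.subset_union_right),
    hA2.trans Finset.subset_union_left⟩, hF A hA3 B (hc hB)⟩, ?_⟩
  rw [Finset.union_sdiff_distrib, hd]
end

section
/- Let F be a nonempty finite union-closed family of finite subsets of a type α, and let F_c ⊆ F. Set S = ⋃F_c and K = ⋃F \ ⋃F_c. Let w : α → ℕ be a weight function on ⋃F with w(x) = 0 for all x ∈ K. If fs(F',w,⋃F_c) ≥ 0 for every F' in uce(F_c), then F satisfies the Frankl condition. -/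
open Finset

variable {α : Type*} [DecidableEq α]

theorem frankl_of_uce_shares_nonneg {α : Type*} [DecidableEq α] (F Fc : Finset (Finset α))
    (hne : F.Nonempty) (huc : unionClosed F) (hsub : Fc ⊆ F) (w : α → ℕ)
    (hw : weightFunOn w (famUnion F))
    (hw0 : ∀ x ∈ famUnion F \ famUnion Fc, w x = 0)
    (h : ∀ F' : Finset (Finset α), uce Fc F' → fs w F' (famUnion Fc) ≥ 0) :
    frankl F := by
  classical
  have hle : ∀ (G : Finset (Finset α)), ∀ B ∈ G, B ⊆ famUnion G := by
    intro G B hB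
    exact Finset.le_sup (f := id) hB
  obtain ⟨S, hS⟩ : ∃ S, S = famUnion Fc := ⟨_, rfl⟩
  rw [← hS] at hw0
  have hBS : ∀ B ∈ Fc, B ⊆ S := by
    intro B hB
    rw [hS]
    exact hle Fc B hB
  have hSF : S ⊆ famUnion F := by
    rw [hS]
    exact Finset.sup_mono hsub
  have key : 0 ≤ ∑ A ∈ F, ss w (A ∩ S) S := by
    rw [← Finset.sum_fiberwise_of_maps_to (t := F.image (fun A => A \ S)) (g := fun A => A \ S)
      (fun A hA => Finset.mem_image_of_mem _ hA)]
    refine Finset.sum_nonneg ?_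
    intro L _
    have hu : uce Fc ((F.filter (fun A => A \ S = L)).image (fun A => A ∩ S)) := by
      refine ⟨?_, ?_, ?_⟩
      · intro A hA
        obtain ⟨A', _, rfl⟩ := Finset.mem_image.1 hA
        rw [← hS]
        exact Finset.inter_subset_right
      · intro A hA B hB
        obtain ⟨A', hA', rfl⟩ := Finset.mem_image.1 hA
        obtain ⟨B', hB', rfl⟩ := Finset.mem_image.1 hB
        rw [Finset.mem_filter] at hA' hB'
        refine Finset.mem_image.2 ⟨A' ∪ B', Finset.mem_filter.2 ⟨huc _ hA'.1 _ hB'.1, ?_⟩, ?_⟩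
        · rw [Finset.union_sdiff_distrib, hA'.2, hB'.2, Finset.union_self]
        · exact Finset.union_inter_distrib_right _ _ _
      · intro A hA B hB
        obtain ⟨A', hA', rfl⟩ := Finset.mem_image.1 hA
        rw [Finset.mem_filter] at hA'
        have hb := hBS B hB
        refine Finset.mem_image.2 ⟨A' ∪ B, Finset.mem_filter.2 ⟨huc _ hA'.1 _ (hsub hB), ?_⟩, ?_⟩
        · rw [Finset.union_sdiff_distrib, hA'.2, Finset.sdiff_eq_empty_iff_subset.2 hb,
            Finset.union_empty]
        · simp only [Finset.union_inter_distrib_right, Finset.inter_eq_left.2 hb]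
    have h1 := h _ hu
    rw [← hS, fs, Finset.sum_image] at h1
    · exact h1
    · intro A hA B hB hAB
      have hA2 := (Finset.mem_filter.1 (Finset.mem_coe.1 hA)).2
      have hB2 := (Finset.mem_filter.1 (Finset.mem_coe.1 hB)).2
      rw [← Finset.sdiff_union_inter A S, ← Finset.sdiff_union_inter B S, hA2, hB2]
      exact congrArg _ hAB
  by_contra hcon
  have hlt : ∀ a ∈ famUnion F, 2 * cnt a F < F.card := by
    intro a ha
    by_contra hc
    exact hcon ⟨a, ha, not_lt.1 hc⟩
  have hsum : ∑ A ∈ F, sw w (A ∩ S) = ∑ a ∈ S, cnt a F * w a := by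
    have e : ∀ A ∈ F, sw w (A ∩ S) = ∑ a ∈ S, if a ∈ A then w a else 0 := by
      intro A _
      rw [sw, Finset.inter_comm, ← Finset.filter_mem_eq_inter, Finset.sum_filter]
    rw [Finset.sum_congr rfl e, Finset.sum_comm]
    refine Finset.sum_congr rfl ?_
    intro a _
    rw [← Finset.sum_filter, Finset.sum_const, smul_eq_mul, cnt]
  have hstrict : ∑ a ∈ S, 2 * cnt a F * w a < ∑ a ∈ S, F.card * w a := by
    obtain ⟨a, ha, hpos⟩ := hw
    have haS : a ∈ S := by
      by_contra hn
      have := hw0 a (Finset.mem_sdiff.2 ⟨ha, hn⟩)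
      omega
    refine Finset.sum_lt_sum ?_ ⟨a, haS, ?_⟩
    · intro b hb
      exact Nat.mul_le_mul_right _ (hlt b (hSF hb)).le
    · exact Nat.mul_lt_mul_of_pos_right (hlt a ha) hpos
  have e2 : ∑ A ∈ F, ss w (A ∩ S) S
      = 2 * ((∑ A ∈ F, sw w (A ∩ S) : ℕ) : ℤ) - (F.card : ℤ) * (sw w S : ℤ) := by
    simp only [ss, Finset.sum_sub_distrib, ← Finset.mul_sum, Finset.sum_const, nsmul_eq_mul]
    push_cast
    ring
  simp only [mul_assoc, ← Finset.mul_sum] at hstrict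
  rw [← hsum] at hstrict
  have h3 : ((2 * ∑ A ∈ F, sw w (A ∩ S) : ℕ) : ℤ) < ((F.card * sw w S : ℕ) : ℤ) :=
    Int.ofNat_lt.2 hstrict
  rw [Nat.cast_mul, Nat.cast_mul] at h3
  rw [e2] at key
  push_cast at h3 key
  linarith
end

section
/- Let F_c be a finite family of finite subsets of a type α. If there exists w : α → ℕ that is a weight function on ⋃F_c such that fs(F',w,⋃F_c) ≥ 0 for every F' in uce(F_c), then every finite union-closed family F of finite subsets of α with F_c ⊆ F satisfies the Frankl condition (i.e., F_c is an FC-family). -/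
open Finset

variable {α : Type*} [DecidableEq α]

theorem fc_family_of_weight {α : Type*} [DecidableEq α] (Fc : Finset (Finset α))
    (h : ∃ w : α → ℕ, weightFunOn w (famUnion Fc) ∧
      ∀ F' : Finset (Finset α), uce Fc F' → fs w F' (famUnion Fc) ≥ 0) :
    ∀ F : Finset (Finset α), unionClosed F → Fc ⊆ F → frankl F := by
  obtain ⟨w, ⟨a₀, ha₀, hw₀⟩, hF'⟩ := h
  intro F hF hsub
  set X := famUnion Fc with hX
  have hFcX : ∀ B ∈ Fc, B ⊆ X := fun B hB => Finset.le_sup (f := id) hB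
  have hXF : X ⊆ famUnion F := Finset.sup_mono hsub
  have key : 0 ≤ ∑ A ∈ F, ss w (A ∩ X) X := by
    rw [← Finset.sum_fiberwise_of_maps_to (s := F) (t := F.image (fun A => A \ X))
      (g := fun A => A \ X) (fun A hA => Finset.mem_image_of_mem _ hA)]
    apply Finset.sum_nonneg
    intro K _
    have h1 := hF' ((F.filter (fun A => A \ X = K)).image (fun A => A ∩ X)) (by
      refine ⟨?_, ?_, ?_⟩
      · intro A hA0
        obtain ⟨B, _, rfl⟩ := Finset.mem_image.1 hA0
        exact Finset.inter_subset_right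
      · intro A hA0 B hB0
        obtain ⟨A, hA, rfl⟩ := Finset.mem_image.1 hA0
        obtain ⟨B, hB, rfl⟩ := Finset.mem_image.1 hB0
        rw [Finset.mem_filter] at hA hB
        refine Finset.mem_image.2 ⟨A ∪ B, Finset.mem_filter.2 ⟨hF _ hA.1 _ hB.1, ?_⟩, ?_⟩
        · rw [Finset.union_sdiff_distrib, hA.2, hB.2, Finset.union_self]
        · exact Finset.union_inter_distrib_right _ _ _
      · intro A hA0 B hB0
        obtain ⟨A, hA, rfl⟩ := Finset.mem_image.1 hA0
        rw [Finset.mem_filter] at hA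
        refine Finset.mem_image.2 ⟨A ∪ B, Finset.mem_filter.2 ⟨hF _ hA.1 _ (hsub hB0), ?_⟩, ?_⟩
        · rw [Finset.union_sdiff_distrib, hA.2, Finset.sdiff_eq_empty_iff_subset.2 (hFcX B hB0),
            Finset.union_empty]
        · change (A ∪ B) ∩ X = A ∩ X ∪ B
          rw [Finset.union_inter_distrib_right, Finset.inter_eq_left.2 (hFcX B hB0)])
    unfold fs at h1
    rw [Finset.sum_image] at h1
    · exact h1
    · intro A hA B hB hAB
      have hA2 := (Finset.mem_filter.1 (Finset.mem_coe.1 hA)).2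
      have hB2 := (Finset.mem_filter.1 (Finset.mem_coe.1 hB)).2
      have hAB : A ∩ X = B ∩ X := hAB
      rw [← Finset.sdiff_union_inter A X, ← Finset.sdiff_union_inter B X, hA2, hB2, hAB]
  have e : ∑ A ∈ F, ss w (A ∩ X) X
      = ∑ a ∈ X, (w a : ℤ) * (2 * (cnt a F : ℤ) - (F.card : ℤ)) := by
    have h2 : ∀ A ∈ F, ss w (A ∩ X) X
        = ∑ a ∈ X, (2 * (if a ∈ A then (w a : ℤ) else 0) - (w a : ℤ)) := by
      intro A _
      unfold ss sw
      rw [Finset.sum_sub_distrib, ← Finset.mul_sum, ← Finset.sum_filter,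
        Finset.filter_mem_eq_inter, Finset.inter_comm X A]
      push_cast
      rfl
    rw [Finset.sum_congr rfl h2, Finset.sum_comm]
    refine Finset.sum_congr rfl fun a _ => ?_
    rw [Finset.sum_sub_distrib, ← Finset.mul_sum, ← Finset.sum_filter]
    simp only [Finset.sum_const, nsmul_eq_mul, cnt]
    ring
  by_contra hn
  have hlt : ∀ a ∈ X, 2 * (cnt a F : ℤ) - (F.card : ℤ) < 0 := by
    intro a ha
    have : ¬ (2 * cnt a F ≥ F.card) := fun hc => hn ⟨a, hXF ha, hc⟩
    omega
  rw [e] at key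
  have : ∑ a ∈ X, (w a : ℤ) * (2 * (cnt a F : ℤ) - (F.card : ℤ)) < 0 := by
    apply Finset.sum_neg'
    · intro a ha
      exact mul_nonpos_of_nonneg_of_nonpos (by positivity) (hlt a ha).le
    · exact ⟨a₀, ha₀, mul_neg_of_pos_of_neg (by exact_mod_cast hw₀) (hlt a₀ ha₀)⟩
  exact absurd key (not_le.2 this)
end

section
/- Let F be a finite union-closed family of finite subsets of a type α, and suppose the singleton {a} is a member of F. Then the element a is contained in at least half of the members of F, i.e., 2 · cnt(a,F) ≥ |F|; in particular F satisfies the Frankl condition. -/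
open Finset

variable {α : Type*} [DecidableEq α]

theorem singleton_fc_family {α : Type*} [DecidableEq α] (F : Finset (Finset α)) (a : α)
    (huc : unionClosed F) (ha : ({a} : Finset α) ∈ F) :
    2 * cnt a F ≥ F.card ∧ frankl F := by
  have key : 2 * cnt a F ≥ F.card := by
    have h1 := Finset.card_filter_add_card_filter_not (s := F) (fun A => a ∈ A)
    have h2 : (F.filter (fun A => ¬ a ∈ A)).card ≤ (F.filter (fun A => a ∈ A)).card := by
      apply Finset.card_le_card_of_injOn (fun A => A ∪ {a})
      · intro A hA
        simp only [Finset.coe_filter, Set.mem_setOf_eq] at hA ⊢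
        exact ⟨huc A hA.1 _ ha, by simp⟩
      · intro A hA B hB h
        simp only [Finset.coe_filter, Set.mem_setOf_eq] at hA hB
        ext x
        have hx := Finset.ext_iff.mp h x
        simp only [Finset.mem_union, Finset.mem_singleton] at hx
        by_cases hxa : x = a
        · subst hxa
          tauto
        · tauto
    unfold cnt
    omega
  refine ⟨key, a, ?_, key⟩
  unfold famUnion
  exact Finset.mem_sup.mpr ⟨{a}, ha, by simp⟩
end

section
/- Let F be a finite union-closed family of finite subsets of a type α, and suppose F contains a two-element set {a,b} with a ≠ b. Then F satisfies the Frankl condition, i.e., there exists an element of ⋃F contained in at least half of the members of F. -/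
open Finset

variable {α : Type*} [DecidableEq α]

theorem two_element_fc_family {α : Type*} [DecidableEq α] (F : Finset (Finset α)) (a b : α)
    (hab : a ≠ b) (huc : unionClosed F) (hmem : ({a, b} : Finset α) ∈ F) :
    frankl F := by
  have h1 : (F.filter (fun A => a ∉ A ∧ b ∉ A)).card
      ≤ (F.filter (fun A => a ∈ A ∧ b ∈ A)).card := by
    apply Finset.card_le_card_of_injOn (fun A => A ∪ {a, b})
    · intro A hA
      have hA' := Finset.mem_filter.1 hA
      exact Finset.mem_coe.2 (Finset.mem_filter.2
        ⟨huc A hA'.1 _ hmem, by simp, by simp⟩)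
    · intro A hA B hB h
      have hA' := (Finset.mem_filter.1 hA).2
      have hB' := (Finset.mem_filter.1 hB).2
      ext x
      have hx := Finset.ext_iff.1 h x
      simp only [Finset.mem_union, Finset.mem_insert, Finset.mem_singleton] at hx
      by_cases hxa : x = a
      · subst hxa; tauto
      · by_cases hxb : x = b
        · subst hxb; tauto
        · tauto
  have h2 : cnt a F + cnt b F + (F.filter (fun A => a ∉ A ∧ b ∉ A)).card
      = F.card + (F.filter (fun A => a ∈ A ∧ b ∈ A)).card := by
    unfold cnt
    rw [Finset.card_filter, Finset.card_filter, Finset.card_filter, Finset.card_filter,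
      Finset.card_eq_sum_ones, ← Finset.sum_add_distrib, ← Finset.sum_add_distrib,
      ← Finset.sum_add_distrib]
    refine Finset.sum_congr rfl fun A _ => ?_
    by_cases ha : a ∈ A <;> by_cases hb : b ∈ A <;> simp [ha, hb]
  have hU : ∀ x ∈ ({a, b} : Finset α), x ∈ famUnion F := fun x hx =>
    Finset.mem_sup.2 ⟨_, hmem, hx⟩
  by_cases h : F.card ≤ 2 * cnt a F
  · exact ⟨a, hU a (by simp), h⟩
  · exact ⟨b, hU b (by simp), by omega⟩
end

section
/- Let F be a finite union-closed family of finite subsets of a type α. Suppose there exist three pairwise distinct sets A₁, A₂, A₃ ∈ F, each of cardinality 3, such that |A₁ ∪ A₂ ∪ A₃| ≤ 5. Then F satisfies the Frankl condition (every uniform 533-family is an FC-family). -/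
open Finset

variable {α : Type*} [DecidableEq α]

def tb (g i : ℕ) : Bool := Nat.beq (Nat.land (Nat.shiftRight g i) 1) 1

def vmin : ℤ → ℤ
  | Int.ofNat _ => 0
  | Int.negSucc n => Int.negSucc n

def vnn : ℤ → Bool
  | Int.ofNat _ => true
  | Int.negSucc _ => false

/-- lower bound of the share of a family containing `g` and avoiding `e` -/
def bnd (g e : ℕ) : List ℤ → ℕ → ℤ
  | [], _ => 0
  | v :: l, i => Int.add (cond (tb g i) v (cond (tb e i) 0 (vmin v))) (bnd g e l (Nat.succ i))

def addU (g x : ℕ) : ℕ → ℕ → ℕ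
  | 0, acc => acc
  | y + 1, acc => addU g x y (cond (tb g y) (Nat.lor acc (Nat.pow 2 (Nat.lor y x))) acc)

def addC (x : ℕ) : List ℕ → ℕ → ℕ
  | [], acc => acc
  | a :: l, acc => addC x l (Nat.lor acc (Nat.pow 2 (Nat.lor x a)))

def search (N : ℕ) (l : List ℤ) (C : List ℕ) : List ℕ → ℕ → ℕ → Bool
  | [], g, e => vnn (bnd g e l 0)
  | x :: L, g, e =>
    cond (vnn (bnd g e l 0)) true
      (cond (tb g x) (search N l C L g e)
        (cond (search N l C L g (Nat.lor e (Nat.pow 2 x)))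
          (search N l C L (addU g x N (addC x C (Nat.lor g (Nat.pow 2 x)))) e) false))

/-- the share of the set with code `n` -/
def shr (k : ℕ) (w : ℕ → ℕ) (n : ℕ) : ℤ :=
  ∑ i ∈ Finset.range k, (if n.testBit i then (w i : ℤ) else -(w i : ℤ))


theorem tb_eq (g i : ℕ) : tb g i = g.testBit i := by
  have h : tb g i = Nat.beq ((g >>> i) &&& 1) 1 := rfl
  rw [h, Nat.testBit, Nat.and_comm]
  have h2 : (1 &&& g >>> i) = 0 ∨ (1 &&& g >>> i) = 1 := by
    rw [Nat.one_and_eq_mod_two]; omega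
  rcases h2 with h2 | h2 <;> rw [h2] <;> rfl

theorem tb_lor (acc z i : ℕ) :
    tb (Nat.lor acc (Nat.pow 2 z)) i = true ↔ tb acc i = true ∨ z = i := by
  have h : tb (Nat.lor acc (Nat.pow 2 z)) i = (acc ||| 2 ^ z).testBit i := tb_eq _ _
  rw [h, tb_eq, Nat.testBit_or, Nat.testBit_two_pow]
  simp

theorem tb_zero (i : ℕ) : tb 0 i = false := by simp [tb_eq]

theorem vmin_le (v : ℤ) : vmin v ≤ v ∧ vmin v ≤ 0 := by
  cases v with
  | ofNat n => simp [vmin]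
  | negSucc n => simp only [vmin]; constructor <;> omega

theorem vnn_iff (v : ℤ) : vnn v = true → 0 ≤ v := by
  cases v with
  | ofNat n => simp
  | negSucc n => simp [vnn]

def tot (H : ℕ → Prop) [DecidablePred H] : List ℤ → ℕ → ℤ
  | [], _ => 0
  | v :: l, i => (if H i then v else 0) + tot H l (i + 1)

theorem tot_eq (H : ℕ → Prop) [DecidablePred H] (l : List ℤ) (i : ℕ) :
    tot H l i = ∑ j ∈ Finset.range l.length, if H (i + j) then l.getD j 0 else 0 := by
  induction l generalizing i with
  | nil => simp [tot]
  | cons v l ih =>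
    rw [tot, ih, List.length_cons, Finset.sum_range_succ']
    simp only [List.getD_cons_succ, List.getD_cons_zero, Nat.add_zero]
    rw [add_comm]
    congr 1
    apply Finset.sum_congr rfl
    intro j _
    rw [show i + 1 + j = i + (j + 1) by omega]

theorem bnd_le (H : ℕ → Prop) [DecidablePred H] (g e : ℕ)
    (hg : ∀ x, tb g x = true → H x) (he : ∀ x, tb e x = true → ¬ H x)
    (l : List ℤ) (i : ℕ) : bnd g e l i ≤ tot H l i := by
  induction l generalizing i with
  | nil => simp [bnd, tot]
  | cons v l ih =>
    have h := ih (i + 1)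
    have hv := vmin_le v
    have h3 : bnd g e (v :: l) i
        = (cond (tb g i) v (cond (tb e i) 0 (vmin v))) + bnd g e l (i + 1) := rfl
    rw [h3, tot]
    have : (cond (tb g i) v (cond (tb e i) 0 (vmin v))) ≤ (if H i then v else 0) := by
      rcases hgi : tb g i with _ | _
      · rcases hei : tb e i with _ | _
        · simp only [cond_false]; split_ifs <;> omega
        · simp [he i hei]
      · simp [hg i hgi]
    omega

theorem addU_sound (H : ℕ → Prop) (g x : ℕ) (hU : ∀ x y, H x → H y → H (x ||| y))
    (hg : ∀ x, tb g x = true → H x) (hx : H x) (n acc : ℕ)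
    (ha : ∀ x, tb acc x = true → H x) : ∀ z, tb (addU g x n acc) z = true → H z := by
  induction n generalizing acc with
  | zero => exact ha
  | succ y ih =>
    rw [addU]
    apply ih
    intro z
    rcases h : tb g y with _ | _
    · exact ha z
    · simp only [cond_true, tb_lor]
      rintro (h1 | rfl)
      · exact ha z h1
      · exact hU _ _ (hg _ h) hx

theorem addC_sound (H : ℕ → Prop) (x : ℕ) (hx : H x) (C : List ℕ) (acc : ℕ)
    (hC : ∀ a ∈ C, ∀ x, H x → H (x ||| a))
    (ha : ∀ x, tb acc x = true → H x) : ∀ z, tb (addC x C acc) z = true → H z := by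
  induction C generalizing acc with
  | nil => exact ha
  | cons a l ih =>
    rw [addC]
    apply ih
    · intro b hb; exact hC b (List.mem_cons_of_mem _ hb)
    intro z
    simp only [tb_lor]
    rintro (h1 | rfl)
    · exact ha z h1
    · exact hC a List.mem_cons_self _ hx

theorem search_sound (H : ℕ → Prop) [DecidablePred H] (N : ℕ) (l : List ℤ) (C : List ℕ)
    (hU : ∀ x y, H x → H y → H (x ||| y))
    (hC : ∀ a ∈ C, ∀ x, H x → H (x ||| a)) (L : List ℕ) (g e : ℕ)
    (hs : search N l C L g e = true)
    (hg : ∀ x, tb g x = true → H x) (he : ∀ x, tb e x = true → ¬ H x) :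
    0 ≤ tot H l 0 := by
  induction L generalizing g e with
  | nil => exact (vnn_iff _ hs).trans (bnd_le H g e hg he l 0)
  | cons x L ih =>
    rw [search] at hs
    rcases hb : vnn (bnd g e l 0) with _ | _
    · rw [hb, cond_false] at hs
      rcases hgx : tb g x with _ | _
      · rw [hgx, cond_false] at hs
        rcases h1 : search N l C L g (Nat.lor e (Nat.pow 2 x)) with _ | _
        · rw [h1] at hs; simp at hs
        · rw [h1, cond_true] at hs
          by_cases hx : H x
          · refine ih _ _ hs ?_ he
            apply addU_sound H g x hU hg hx
            apply addC_sound H x hx C _ hC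
            intro z
            rw [tb_lor]
            rintro (h | rfl)
            · exact hg z h
            · exact hx
          · refine ih _ _ h1 hg ?_
            intro z
            rw [tb_lor]
            rintro (h | rfl)
            · exact he z h
            · exact hx
      · rw [hgx, cond_true] at hs
        exact ih _ _ hs hg he
    · exact (vnn_iff _ hb).trans (bnd_le H g e hg he l 0)

/-- the set with code `n` w.r.t. the points `p 0, …, p (k-1)` -/
def dcd {β : Type*} [DecidableEq β] (k : ℕ) (p : ℕ → β) (n : ℕ) : Finset β :=
  ((Finset.range k).filter (fun i => n.testBit i = true)).image p

def cod {β : Type*} [DecidableEq β] (k : ℕ) (p : ℕ → β) (A : Finset β) : ℕ :=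
  Nat.ofBits (fun i : Fin k => decide (p i ∈ A))

theorem mem_dcd {β : Type*} [DecidableEq β] (k : ℕ) (p : ℕ → β) (n : ℕ) (x : β) :
    x ∈ dcd k p n ↔ ∃ i < k, n.testBit i = true ∧ p i = x := by
  simp [dcd, and_assoc]

theorem dcd_or {β : Type*} [DecidableEq β] (k : ℕ) (p : ℕ → β) (m n : ℕ) :
    dcd k p (m ||| n) = dcd k p m ∪ dcd k p n := by
  ext x
  simp only [Finset.mem_union, mem_dcd, Nat.testBit_or, Bool.or_eq_true]
  grind

theorem cod_lt {β : Type*} [DecidableEq β] (k : ℕ) (p : ℕ → β) (A : Finset β) :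
    cod k p A < 2 ^ k := Nat.ofBits_lt_two_pow _

theorem testBit_cod {β : Type*} [DecidableEq β] (k : ℕ) (p : ℕ → β) (A : Finset β) (i : ℕ)
    (hi : i < k) : (cod k p A).testBit i = decide (p i ∈ A) := by
  rw [cod, Nat.testBit_ofBits_lt _ _ hi]

theorem frankl_core {β : Type*} [DecidableEq β] (F : Finset (Finset β)) (huc : unionClosed F)
    (k : ℕ) (p : ℕ → β) (hp : ∀ i < k, ∀ j < k, p i = p j → i = j)
    (w : ℕ → ℕ) (l : List ℤ) (hl : l = (List.range (2 ^ k)).map (shr k w))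
    (hw : ∃ i < k, 0 < w i)
    (N : ℕ) (C L : List ℕ) (hC : ∀ a ∈ C, dcd k p a ∈ F)
    (hall : ∀ i < k, ∃ A ∈ F, p i ∈ A)
    (hs : search N l C L 0 0 = true) : frankl F := by
  classical
  set S := (Finset.range k).image p with hS
  have hlen : l.length = 2 ^ k := by simp [hl]
  have hget : ∀ n < 2 ^ k, l.getD n 0 = shr k w n := by
    intro n hn
    rw [hl, List.getD_eq_getElem _ _ (by simpa using hn)]
    simp
  have hcov : ∀ A K : Finset β, A \ S = K → K ∪ dcd k p (cod k p A) = A := by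
    rintro A K rfl
    ext x
    simp only [Finset.mem_union, Finset.mem_sdiff, mem_dcd, hS, Finset.mem_image,
      Finset.mem_range]
    constructor
    · rintro (h | ⟨i, hi, h, rfl⟩)
      · exact h.1
      · simpa [testBit_cod k p A i hi] using h
    · intro h
      by_cases h' : ∃ a < k, p a = x
      · obtain ⟨i, hi, rfl⟩ := h'
        exact Or.inr ⟨i, hi, by simpa [testBit_cod k p A i hi] using h, rfl⟩
      · exact Or.inl ⟨h, h'⟩
  have hfib : ∀ K : Finset β, 0 ≤ ∑ A ∈ F with A \ S = K, shr k w (cod k p A) := by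
    intro K
    by_cases hK : Disjoint K S
    swap
    · rw [Finset.sum_eq_zero]
      intro A hA
      exfalso
      apply hK
      rw [← (Finset.mem_filter.1 hA).2]
      exact Finset.sdiff_disjoint
    have hcd : ∀ n < 2 ^ k, cod k p (K ∪ dcd k p n) = n := by
      intro n hn
      apply Nat.eq_of_testBit_eq
      intro i
      by_cases hi : i < k
      · rw [testBit_cod k p _ i hi, Bool.eq_iff_iff, decide_eq_true_iff, Finset.mem_union,
          mem_dcd]
        constructor
        · rintro (h | ⟨j, hj, h, hij⟩)
          · exfalso
            exact Finset.disjoint_left.1 hK h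
              (Finset.mem_image_of_mem _ (Finset.mem_range.2 hi))
          · rw [← hp j hj i hi hij]; exact h
        · intro h
          exact Or.inr ⟨i, hi, h, rfl⟩
      · have h2 : 2 ^ k ≤ 2 ^ i := Nat.pow_le_pow_right (by norm_num) (by omega)
        rw [Nat.testBit_lt_two_pow ((cod_lt k p _).trans_le h2),
          Nat.testBit_lt_two_pow (hn.trans_le h2)]
    have h0 := search_sound (fun n => K ∪ dcd k p n ∈ F) N l C ?_ ?_ L 0 0 hs ?_ ?_
    · rw [tot_eq, hlen] at h0
      refine h0.trans_eq ?_
      rw [← Finset.sum_filter]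
      simp only [Nat.zero_add]
      refine Finset.sum_nbij' (fun n => K ∪ dcd k p n) (fun A => cod k p A) ?_ ?_ ?_ ?_ ?_
      · intro n hn
        simp only [Finset.mem_filter, Finset.mem_range] at hn ⊢
        refine ⟨hn.2, ?_⟩
        have h1 : dcd k p n ⊆ S := Finset.image_subset_image (Finset.filter_subset _ _)
        rw [Finset.union_sdiff_distrib, Finset.sdiff_eq_self_of_disjoint hK,
          Finset.sdiff_eq_empty_iff_subset.2 h1, Finset.union_empty]
      · intro A hA
        simp only [Finset.mem_filter, Finset.mem_range] at hA ⊢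
        refine ⟨cod_lt _ _ _, ?_⟩
        convert hA.1
        exact hcov A K hA.2
      · intro n hn
        simp only [Finset.mem_filter, Finset.mem_range] at hn
        exact hcd n hn.1
      · intro A hA
        simp only [Finset.mem_filter, Finset.mem_range] at hA ⊢
        exact hcov A K hA.2
      · intro n hn
        simp only [Finset.mem_filter, Finset.mem_range] at hn
        rw [hget n hn.1]
        rw [hcd n hn.1]
    · intro x y hx hy
      have := huc _ hx _ hy
      rwa [dcd_or, Finset.union_union_distrib_left]
    · intro a ha x hx
      have := huc _ hx _ (hC a ha)
      rwa [dcd_or, ← Finset.union_assoc]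
    · intro x hx; rw [tb_zero] at hx; cases hx
    · intro x hx; rw [tb_zero] at hx; cases hx
  have htot : 0 ≤ ∑ A ∈ F, shr k w (cod k p A) := by
    rw [← Finset.sum_fiberwise_of_maps_to (s := F) (t := F.image (fun A => A \ S))
      (g := fun A => A \ S) (fun A hA => Finset.mem_image_of_mem _ hA)]
    exact Finset.sum_nonneg (fun K _ => hfib K)
  have hsw : ∑ A ∈ F, shr k w (cod k p A)
      = ∑ i ∈ Finset.range k, (w i : ℤ) * (2 * (cnt (p i) F : ℤ) - F.card) := by
    unfold shr
    rw [Finset.sum_comm]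
    apply Finset.sum_congr rfl
    intro i hi
    have hi' := Finset.mem_range.1 hi
    have h1 : ∀ A ∈ F, (if (cod k p A).testBit i = true then (w i : ℤ) else -(w i : ℤ))
        = (w i : ℤ) * (2 * (if p i ∈ A then 1 else 0) - 1) := by
      intro A _
      rw [testBit_cod k p A i hi']
      by_cases h : p i ∈ A <;> simp [h]
    rw [Finset.sum_congr rfl h1, ← Finset.mul_sum, Finset.sum_sub_distrib, ← Finset.mul_sum]
    simp [cnt]
  rw [hsw] at htot
  by_contra hf
  have hneg : ∀ i < k, 2 * (cnt (p i) F : ℤ) - F.card < 0 := by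
    intro i hi
    by_contra h
    apply hf
    refine ⟨p i, ?_, by omega⟩
    obtain ⟨A, hA, hiA⟩ := hall i hi
    rw [famUnion, Finset.mem_sup]
    exact ⟨A, hA, hiA⟩
  obtain ⟨i, hi, hwi⟩ := hw
  have : ∑ i ∈ Finset.range k, (w i : ℤ) * (2 * (cnt (p i) F : ℤ) - F.card) < 0 := by
    apply Finset.sum_neg'
    · intro j hj
      have := hneg j (Finset.mem_range.1 hj)
      exact mul_nonpos_of_nonneg_of_nonpos (by positivity) this.le
    · exact ⟨i, Finset.mem_range.2 hi, mul_neg_of_pos_of_neg (by exact_mod_cast hwi) (hneg i hi)⟩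
  omega

theorem frankl_three {β : Type*} [DecidableEq β] (F : Finset (Finset β)) (huc : unionClosed F)
    (k : ℕ) (p : ℕ → β) (hp : ∀ i < k, ∀ j < k, p i = p j → i = j)
    (w : ℕ → ℕ) (l : List ℤ) (hl : l = (List.range (2 ^ k)).map (shr k w))
    (hw : ∃ i < k, 0 < w i)
    (N : ℕ) (L : List ℕ) (a b c ab ac bc abc : ℕ)
    (e₁ : ab = a ||| b) (e₂ : ac = a ||| c) (e₃ : bc = b ||| c) (e₄ : abc = a ||| b ||| c)
    (hab : ∀ i < k, abc.testBit i = true)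
    (h : ∀ x ∈ [a, b, c], dcd k p x ∈ F)
    (hs : search N l [a, b, c, ab, ac, bc, abc] L 0 0 = true) : frankl F := by
  have ha := h a (by simp)
  have hb := h b (by simp)
  have hc := h c (by simp)
  have h4 : dcd k p abc ∈ F := by
    rw [e₄, dcd_or, dcd_or]; exact huc _ (huc _ ha _ hb) _ hc
  refine frankl_core F huc k p hp w l hl hw N _ L ?_ ?_ hs
  · intro x hx
    simp only [List.mem_cons, List.not_mem_nil, or_false] at hx
    rcases hx with rfl | rfl | rfl | rfl | rfl | rfl | rfl
    · exact ha
    · exact hb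
    · exact hc
    · rw [e₁, dcd_or]; exact huc _ ha _ hb
    · rw [e₂, dcd_or]; exact huc _ ha _ hc
    · rw [e₃, dcd_or]; exact huc _ hb _ hc
    · exact h4
  · intro i hi
    exact ⟨_, h4, (mem_dcd _ _ _ _).2 ⟨i, hi, hab i hi, rfl⟩⟩

def actN (σ : List ℕ) (a : ℕ) : ℕ → ℕ
  | 0 => 0
  | n + 1 => cond (tb a n) (Nat.lor (actN σ a n) (Nat.pow 2 (σ.getD n 0))) (actN σ a n)

theorem tb_actN (σ : List ℕ) (a n j : ℕ) :
    tb (actN σ a n) j = true ↔ ∃ i < n, a.testBit i = true ∧ σ.getD i 0 = j := by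
  induction n with
  | zero => simp [actN, tb_zero]
  | succ n ih =>
    rw [actN]
    simp only [Nat.lt_succ_iff_lt_or_eq, or_and_right, exists_or, exists_eq_left]
    rw [← ih, ← tb_eq a n]
    rcases h : tb a n with _ | _
    · simp
    · simp only [cond_true, tb_lor, true_and]

theorem dcd_actN {β : Type*} [DecidableEq β] (k : ℕ) (q : ℕ → β) (σ : List ℕ)
    (hσ : ∀ i < k, σ.getD i 0 < k) (a : ℕ) :
    dcd k (fun i => q (σ.getD i 0)) a = dcd k q (actN σ a k) := by
  ext x
  simp only [mem_dcd, ← tb_eq (actN σ a k), tb_actN]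
  constructor
  · rintro ⟨i, hi, h, rfl⟩
    exact ⟨_, hσ i hi, ⟨i, hi, h, rfl⟩, rfl⟩
  · rintro ⟨j, hj, ⟨i, hi, h, rfl⟩, rfl⟩
    exact ⟨i, hi, h, rfl⟩

def lmem (x : ℕ) : List ℕ → Bool
  | [] => false
  | y :: l => cond (Nat.beq x y) true (lmem x l)

theorem lmem_iff (x : ℕ) (l : List ℕ) : lmem x l = true ↔ x ∈ l := by
  induction l with
  | nil => simp [lmem]
  | cons y l ih =>
    rw [lmem]
    rcases h : Nat.beq x y with _ | _
    · have : x ≠ y := Nat.ne_of_beq_eq_false h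
      simp [ih, this]
    · have : x = y := Nat.eq_of_beq_eq_true h
      simp [this]

def chk (k : ℕ) (T : List ℕ) (Ts : List (List ℕ)) (P : List (List ℕ)) : Bool :=
  T.all fun m₁ => T.all fun m₂ => cond (Nat.blt m₁ m₂) (T.all fun m₃ =>
    cond (Nat.blt m₂ m₃)
      (cond (Nat.beq (Nat.lor (Nat.lor m₁ m₂) m₃) (Nat.pow 2 k - 1))
        (P.any fun σ => Ts.any fun t => t.all fun a => lmem (actN σ a k) [m₁, m₂, m₃])
        true) true) true

theorem chk_sound (k : ℕ) (T : List ℕ) (Ts : List (List ℕ)) (P : List (List ℕ))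
    (h : chk k T Ts P = true) (m₁ m₂ m₃ : ℕ) (h₁ : m₁ ∈ T) (h₂ : m₂ ∈ T) (h₃ : m₃ ∈ T)
    (h₁₂ : m₁ < m₂) (h₂₃ : m₂ < m₃) (hu : m₁ ||| m₂ ||| m₃ = 2 ^ k - 1) :
    ∃ σ ∈ P, ∃ t ∈ Ts, ∀ a ∈ t, actN σ a k ∈ [m₁, m₂, m₃] := by
  unfold chk at h
  have g := List.all_eq_true.1 (List.all_eq_true.1 h m₁ h₁) m₂ h₂
  have b1 : Nat.blt m₁ m₂ = true := by rw [Nat.blt_eq]; exact h₁₂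
  have b2 : Nat.blt m₂ m₃ = true := by rw [Nat.blt_eq]; exact h₂₃
  have b3 : Nat.beq (Nat.lor (Nat.lor m₁ m₂) m₃) (Nat.pow 2 k - 1) = true := by
    rw [Nat.beq_eq]; exact hu
  rw [b1, cond_true] at g
  have g := List.all_eq_true.1 g m₃ h₃
  rw [b2, cond_true, b3, cond_true] at g
  simpa only [List.any_eq_true, List.all_eq_true, lmem_iff] using g

theorem chk5 : chk 5 [7, 11, 13, 14, 19, 21, 22, 25, 26, 28]
    [[28, 26, 25], [28, 25, 19], [28, 25, 7]] (List.permutations' [0, 1, 2, 3, 4]) = true := by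
  decide +kernel

theorem chk4 : chk 4 [7, 11, 13, 14]
    [[7, 11, 13]] (List.permutations' [0, 1, 2, 3]) = true := by
  decide +kernel

theorem card5 : ∀ n < 2 ^ 5, ((Finset.range 5).filter (fun i => n.testBit i = true)).card = 3 →
    n ∈ [7, 11, 13, 14, 19, 21, 22, 25, 26, 28] := by decide +kernel

theorem card4 : ∀ n < 2 ^ 4, ((Finset.range 4).filter (fun i => n.testBit i = true)).card = 3 →
    n ∈ [7, 11, 13, 14] := by decide +kernel

theorem fam_sorted {β : Type*} [DecidableEq β] (F : Finset (Finset β))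
    (k : ℕ) (q : ℕ → β) (hq : ∀ i < k, ∀ j < k, q i = q j → i = j)
    (T : List ℕ) (Ts : List (List ℕ))
    (hchk : chk k T Ts (List.permutations' (List.range k)) = true)
    (hTs : ∀ t ∈ Ts, ∀ p : ℕ → β, (∀ i < k, ∀ j < k, p i = p j → i = j) →
      (∀ a ∈ t, dcd k p a ∈ F) → frankl F)
    (m₁ m₂ m₃ : ℕ) (h₁ : m₁ ∈ T) (h₂ : m₂ ∈ T) (h₃ : m₃ ∈ T)
    (g₁ : dcd k q m₁ ∈ F) (g₂ : dcd k q m₂ ∈ F) (g₃ : dcd k q m₃ ∈ F)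
    (hu : m₁ ||| m₂ ||| m₃ = 2 ^ k - 1)
    (h₁₂ : m₁ < m₂) (h₂₃ : m₂ < m₃) : frankl F := by
  obtain ⟨σ, hσ, t, ht, h⟩ := chk_sound k T Ts _ hchk m₁ m₂ m₃ h₁ h₂ h₃ h₁₂ h₂₃ hu
  rw [List.mem_permutations'] at hσ
  have hlen : σ.length = k := by simpa using hσ.length_eq
  have hnd : σ.Nodup := hσ.nodup_iff.2 List.nodup_range
  have hlt : ∀ i < k, σ.getD i 0 < k := by
    intro i hi
    rw [List.getD_eq_getElem _ _ (by omega)]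
    exact List.mem_range.1 (hσ.subset (List.getElem_mem _))
  refine hTs t ht (fun i => q (σ.getD i 0)) ?_ ?_
  · intro i hi j hj hij
    have := hq _ (hlt i hi) _ (hlt j hj) hij
    rw [List.getD_eq_getElem _ _ (by omega), List.getD_eq_getElem _ _ (by omega)] at this
    exact (hnd.getElem_inj_iff).1 this
  · intro a ha
    rw [dcd_actN k q σ hlt]
    have := h a ha
    simp only [List.mem_cons, List.not_mem_nil, or_false] at this
    rcases this with h | h | h <;> rw [h] <;> assumption

theorem fam_any {β : Type*} [DecidableEq β] (F : Finset (Finset β))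
    (k : ℕ) (T : List ℕ) (Ts : List (List ℕ))
    (hchk : chk k T Ts (List.permutations' (List.range k)) = true)
    (hT : ∀ n < 2 ^ k, ((Finset.range k).filter (fun i => n.testBit i = true)).card = 3 → n ∈ T)
    (hTs : ∀ t ∈ Ts, ∀ p : ℕ → β, (∀ i < k, ∀ j < k, p i = p j → i = j) →
      (∀ a ∈ t, dcd k p a ∈ F) → frankl F)
    (A₁ A₂ A₃ : Finset β)
    (h₁ : A₁ ∈ F) (h₂ : A₂ ∈ F) (h₃ : A₃ ∈ F)
    (hne₁₂ : A₁ ≠ A₂) (hne₁₃ : A₁ ≠ A₃) (hne₂₃ : A₂ ≠ A₃)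
    (hc₁ : A₁.card = 3) (hc₂ : A₂.card = 3) (hc₃ : A₃.card = 3)
    (hu : (A₁ ∪ A₂ ∪ A₃).card = k) : frankl F := by
  set S := A₁ ∪ A₂ ∪ A₃ with hS
  have x₀ : β := (Finset.card_pos.1 (by omega : 0 < A₁.card)).choose
  let e := S.equivFinOfCardEq hu
  let q : ℕ → β := fun i => if h : i < k then (e.symm ⟨i, h⟩ : β) else x₀
  have hqe : ∀ i (h : i < k), q i = e.symm ⟨i, h⟩ := fun i h => by simp [q, h]
  have hq : ∀ i < k, ∀ j < k, q i = q j → i = j := by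
    intro i hi j hj hij
    rw [hqe i hi, hqe j hj] at hij
    simpa using e.symm.injective (Subtype.ext hij)
  have hqS : ∀ i < k, q i ∈ S := by
    intro i hi; rw [hqe i hi]; exact (e.symm _).2
  have hqs : ∀ x ∈ S, ∃ i < k, q i = x := by
    intro x hx
    refine ⟨e ⟨x, hx⟩, (e ⟨x, hx⟩).2, ?_⟩
    rw [hqe _ (e ⟨x, hx⟩).2]; simp
  have hdc : ∀ A ⊆ S, dcd k q (cod k q A) = A := by
    intro A hA
    ext x
    rw [mem_dcd]
    constructor
    · rintro ⟨i, hi, h, rfl⟩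
      simpa [testBit_cod k q A i hi] using h
    · intro hx
      obtain ⟨i, hi, rfl⟩ := hqs x (hA hx)
      exact ⟨i, hi, by simpa [testBit_cod k q A i hi] using hx, rfl⟩
  have hmT : ∀ A ⊆ S, A.card = 3 → cod k q A ∈ T := by
    intro A hA hc
    apply hT _ (cod_lt _ _ _)
    rw [← hc]
    conv_rhs => rw [← hdc A hA, dcd]
    rw [Finset.card_image_of_injOn]
    intro i hi j hj hij
    simp only [Finset.coe_filter, Finset.mem_range, Set.mem_ofPred_eq] at hi hj
    exact hq i hi.1 j hj.1 hij
  have s₁ : A₁ ⊆ S := by intro x hx; simp [hS, hx]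
  have s₂ : A₂ ⊆ S := by intro x hx; simp [hS, hx]
  have s₃ : A₃ ⊆ S := by intro x hx; simp [hS, hx]
  have hinj : ∀ A ⊆ S, ∀ B ⊆ S, A ≠ B → cod k q A ≠ cod k q B := by
    intro A hA B hB hne h
    apply hne
    rw [← hdc A hA, ← hdc B hB, h]
  have hor : cod k q A₁ ||| cod k q A₂ ||| cod k q A₃ = 2 ^ k - 1 := by
    apply Nat.eq_of_testBit_eq
    intro i
    rw [Nat.testBit_two_pow_sub_one, Nat.testBit_or, Nat.testBit_or]
    by_cases hi : i < k
    · have := hqS i hi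
      simp only [testBit_cod k q _ i hi]
      simpa [hS, hi, or_assoc] using this
    · have h2 : 2 ^ k ≤ 2 ^ i := Nat.pow_le_pow_right (by norm_num) (by omega)
      simp [Nat.testBit_lt_two_pow ((cod_lt k q _).trans_le h2), hi]
  have key := fam_sorted F k q hq T Ts hchk hTs
  have m₁ := hmT A₁ s₁ hc₁
  have m₂ := hmT A₂ s₂ hc₂
  have m₃ := hmT A₃ s₃ hc₃
  have g₁ := hdc A₁ s₁
  have g₂ := hdc A₂ s₂
  have g₃ := hdc A₃ s₃
  have n₁₂ := hinj A₁ s₁ A₂ s₂ hne₁₂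
  have n₁₃ := hinj A₁ s₁ A₃ s₃ hne₁₃
  have n₂₃ := hinj A₂ s₂ A₃ s₃ hne₂₃
  rw [← g₁] at h₁
  rw [← g₂] at h₂
  rw [← g₃] at h₃
  generalize cod k q A₁ = a at *
  generalize cod k q A₂ = b at *
  generalize cod k q A₃ = c at *
  rcases lt_or_gt_of_ne n₁₂ with u | u <;> rcases lt_or_gt_of_ne n₁₃ with v | v <;>
    rcases lt_or_gt_of_ne n₂₃ with z | z
  · exact key a b c m₁ m₂ m₃ h₁ h₂ h₃ hor u z
  · exact key a c b m₁ m₃ m₂ h₁ h₃ h₂ (by rw [← hor]; ac_rfl) v z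
  · omega
  · exact key c a b m₃ m₁ m₂ h₃ h₁ h₂ (by rw [← hor]; ac_rfl) v u
  · exact key b a c m₂ m₁ m₃ h₂ h₁ h₃ (by rw [← hor]; ac_rfl) u v
  · omega
  · exact key b c a m₂ m₃ m₁ h₂ h₃ h₁ (by rw [← hor]; ac_rfl) z v
  · exact key c b a m₃ m₂ m₁ h₃ h₂ h₁ (by rw [← hor]; ac_rfl) z u

theorem ok_tri : search 32 [-12, -8, -8, -4, -8, -4, -4, 0, -6, -2, -2, 2, -2, 2, 2, 6, -6, -2, -2, 2, -2, 2, 2, 6, 0, 4, 4, 8, 4, 8, 8, 12] [28, 26, 25, 30, 29, 27, 31]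
    [0, 1, 2, 4, 8, 16, 3, 5, 6, 9, 10, 12, 17, 18, 20] 0 0 = true := by decide +kernel
theorem tab_tri : [-12, -8, -8, -4, -8, -4, -4, 0, -6, -2, -2, 2, -2, 2, 2, 6, -6, -2, -2, 2, -2, 2, 2, 6, 0, 4, 4, 8, 4, 8, 8, 12] = (List.range 32).map (shr 5 (fun i => [2, 2, 2, 3, 3].getD i 0)) := by decide +kernel

theorem ok_star : search 16 [-4, -2, -2, 0, -2, 0, 0, 2, -2, 0, 0, 2, 0, 2, 2, 4] [7, 11, 13, 15, 15, 15, 15]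
    [0, 1, 2, 4, 8] 0 0 = true := by decide +kernel
theorem tab_star : [-4, -2, -2, 0, -2, 0, 0, 2, -2, 0, 0, 2, 0, 2, 2, 4] = (List.range 16).map (shr 4 (fun i => [1, 1, 1, 1].getD i 0)) := by decide +kernel

theorem ok_P4 : search 32 [-14, -8, -10, -4, -10, -4, -6, 0, -8, -2, -4, 2, -4, 2, 0, 6, -6, 0, -2, 4, -2, 4, 2, 8, 0, 6, 4, 10, 4, 10, 8, 14] [28, 25, 19, 29, 31, 27, 31]
    [0, 2, 4, 1, 8, 16, 6, 3, 5, 10, 12, 9, 18, 20] 0 0 = true := by decide +kernel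
theorem tab_P4 : [-14, -8, -10, -4, -10, -4, -6, 0, -8, -2, -4, 2, -4, 2, 0, 6, -6, 0, -2, 4, -2, 4, 2, 8, 0, 6, 4, 10, 4, 10, 8, 14] = (List.range 32).map (shr 5 (fun i => [3, 2, 2, 3, 4].getD i 0)) := by decide +kernel

theorem ok_P3K2 : search 32 [-16, -8, -12, -4, -8, 0, -4, 4, -10, -2, -6, 2, -2, 6, 2, 10, -10, -2, -6, 2, -2, 6, 2, 10, -4, 4, 0, 8, 4, 12, 8, 16] [28, 25, 7, 29, 31, 31, 31]
    [0, 2, 8, 16, 1, 4, 10, 18, 3, 6, 24, 9, 12, 17, 20] 0 0 = true := by decide +kernel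
theorem tab_P3K2 : [-16, -8, -12, -4, -8, 0, -4, 4, -10, -2, -6, 2, -2, 6, 2, 10, -10, -2, -6, 2, -2, 6, 2, 10, -4, 4, 0, 8, 4, 12, 8, 16] = (List.range 32).map (shr 5 (fun i => [4, 2, 4, 3, 3].getD i 0)) := by decide +kernel

theorem uniform_533_fc_family {α : Type*} [DecidableEq α] (F : Finset (Finset α))
    (huc : unionClosed F) (A₁ A₂ A₃ : Finset α)
    (h₁ : A₁ ∈ F) (h₂ : A₂ ∈ F) (h₃ : A₃ ∈ F)
    (hne₁₂ : A₁ ≠ A₂) (hne₁₃ : A₁ ≠ A₃) (hne₂₃ : A₂ ≠ A₃)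
    (hc₁ : A₁.card = 3) (hc₂ : A₂.card = 3) (hc₃ : A₃.card = 3)
    (hu : (A₁ ∪ A₂ ∪ A₃).card ≤ 5) :
    frankl F := by
  have h4 : 4 ≤ (A₁ ∪ A₂ ∪ A₃).card := by
    by_contra hlt
    have e1 : A₁ = A₁ ∪ A₂ ∪ A₃ :=
      Finset.eq_of_subset_of_card_le (fun x hx => by simp [hx]) (by omega)
    have e2 : A₂ = A₁ ∪ A₂ ∪ A₃ :=
      Finset.eq_of_subset_of_card_le (fun x hx => by simp [hx]) (by omega)
    exact hne₁₂ (e1.trans e2.symm)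
  rcases (by omega : (A₁ ∪ A₂ ∪ A₃).card = 4 ∨ (A₁ ∪ A₂ ∪ A₃).card = 5) with h | h
  · refine fam_any F 4 _ _ chk4 card4 ?_ A₁ A₂ A₃ h₁ h₂ h₃ hne₁₂ hne₁₃ hne₂₃ hc₁ hc₂ hc₃ h
    intro t ht p hp hF
    simp only [List.mem_cons, List.not_mem_nil, or_false] at ht
    rcases ht with rfl
    exact frankl_three F huc 4 p hp _ _ tab_star ⟨0, by decide⟩ _ _ _ _ _ _ _ _ _
      (by decide) (by decide) (by decide) (by decide) (by decide) hF ok_star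
  · refine fam_any F 5 _ _ chk5 card5 ?_ A₁ A₂ A₃ h₁ h₂ h₃ hne₁₂ hne₁₃ hne₂₃ hc₁ hc₂ hc₃ h
    intro t ht p hp hF
    simp only [List.mem_cons, List.not_mem_nil, or_false] at ht
    rcases ht with rfl | rfl | rfl
    · exact frankl_three F huc 5 p hp _ _ tab_tri ⟨0, by decide⟩ _ _ _ _ _ _ _ _ _
        (by decide) (by decide) (by decide) (by decide) (by decide) hF ok_tri
    · exact frankl_three F huc 5 p hp _ _ tab_P4 ⟨0, by decide⟩ _ _ _ _ _ _ _ _ _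
        (by decide) (by decide) (by decide) (by decide) (by decide) hF ok_P4
    · exact frankl_three F huc 5 p hp _ _ tab_P3K2 ⟨0, by decide⟩ _ _ _ _ _ _ _ _ _
        (by decide) (by decide) (by decide) (by decide) (by decide) hF ok_P3K2
end

section
/- Let F be a finite union-closed family of finite subsets of a type α. Suppose there exist four pairwise distinct sets A₁, A₂, A₃, A₄ ∈ F, each of cardinality 3, such that |A₁ ∪ A₂ ∪ A₃ ∪ A₄| ≤ 6. Then F satisfies the Frankl condition (every uniform 634-family is an FC-family). -/
open Finset

variable {α : Type*} [DecidableEq α]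

namespace FC

/-- Force evaluation of a natural number (for kernel reduction). -/
noncomputable def force (n : ℕ) (k : ℕ → Bool) : Bool := Nat.rec (k 0) (fun n _ => k (n + 1)) n

theorem force_eq (n : ℕ) (k : ℕ → Bool) : force n k = k n := by cases n <;> rfl

noncomputable def forceL : List (ℕ × ℕ) → (List (ℕ × ℕ) → Bool) → Bool
  | [], k => k []
  | x :: t, k => force x.1 fun m => force x.2 fun c => forceL t fun t' => k ((m, c) :: t')

theorem forceL_eq (l : List (ℕ × ℕ)) (k : List (ℕ × ℕ) → Bool) : forceL l k = k l := by
  induction l generalizing k with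
  | nil => rfl
  | cons x t ih => simp [forceL, force_eq, ih]

def st (B C M G a : ℕ) : ℕ :=
  bif Nat.beq (Nat.land a B) 0 then G
  else Nat.lor (Nat.shiftLeft (Nat.land G C) B) (Nat.land G M)

theorem st_eq (i C M G a : ℕ) : st (2 ^ i) C M G a =
    bif a.testBit i then ((G &&& C) <<< (2 ^ i)) ||| (G &&& M) else G := by
  have h : Nat.land a (2 ^ i) = (a.testBit i).toNat * 2 ^ i := Nat.and_two_pow a i
  have hp : 2 ^ i ≠ 0 := by positivity
  unfold st
  rw [h]
  cases a.testBit i with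
  | false => simp
  | true =>
    have : Nat.beq (true.toNat * 2 ^ i) 0 = false := by
      rw [← Bool.not_eq_true, Nat.beq_eq]; simp
    rw [this]; rfl

theorem st_spec (i C M G a k : ℕ)
    (hC : ∀ s, C.testBit s = true → s + 2 ^ i = s ||| 2 ^ i)
    (hM : ∀ s, M.testBit s = true → s = s ||| 2 ^ i)
    (h : (st (2 ^ i) C M G a).testBit k = true) :
    ∃ s, G.testBit s = true ∧ k = s ||| (a &&& 2 ^ i) := by
  rw [st_eq] at h
  rw [Nat.and_two_pow]
  cases ha : a.testBit i with
  | false => exact ⟨k, by simpa [ha] using h, by simp⟩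
  | true =>
    simp only [ha, cond_true, Nat.testBit_or, Nat.testBit_shiftLeft, Nat.testBit_and,
      Bool.or_eq_true, Bool.and_eq_true, decide_eq_true_eq] at h
    rcases h with ⟨h1, h2, h3⟩ | ⟨h1, h2⟩
    · refine ⟨k - 2 ^ i, h2, ?_⟩
      have := hC _ h3
      simp only [Bool.toNat_true, one_mul]
      omega
    · exact ⟨k, h1, by simpa using hM _ h2⟩

theorem tb64 (C : ℕ) (hC : C < 2 ^ 64) (P : ℕ → Prop)
    (h : ∀ s < 64, C.testBit s = true → P s) (s : ℕ) (hs : C.testBit s = true) : P s := by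
  apply h s _ hs
  by_contra hlt
  have : C < 2 ^ s := lt_of_lt_of_le hC (Nat.pow_le_pow_right (by norm_num) (by omega))
  rw [Nat.testBit_lt_two_pow this] at hs
  exact absurd hs (by simp)

def un (G a : ℕ) : ℕ :=
  st 32 4294967295 18446744069414584320
    (st 16 281470681808895 18446462603027742720
    (st 8 71777214294589695 18374966859414961920
    (st 4 1085102592571150095 17361641481138401520
    (st 2 3689348814741910323 14757395258967641292
    (st 1 6148914691236517205 12297829382473034410 G a) a) a) a) a) a

theorem un_spec (G a k : ℕ) (ha : a < 64) (h : (un G a).testBit k = true) :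
    ∃ s, G.testBit s = true ∧ k = s ||| a := by
  unfold un at h
  obtain ⟨s5, h5, e5⟩ := st_spec 5 _ _ _ _ _ (tb64 _ (by norm_num) _ (by decide +kernel))
    (tb64 _ (by norm_num) _ (by decide +kernel)) h
  obtain ⟨s4, h4, e4⟩ := st_spec 4 _ _ _ _ _ (tb64 _ (by norm_num) _ (by decide +kernel))
    (tb64 _ (by norm_num) _ (by decide +kernel)) h5
  obtain ⟨s3, h3, e3⟩ := st_spec 3 _ _ _ _ _ (tb64 _ (by norm_num) _ (by decide +kernel))
    (tb64 _ (by norm_num) _ (by decide +kernel)) h4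
  obtain ⟨s2, h2, e2⟩ := st_spec 2 _ _ _ _ _ (tb64 _ (by norm_num) _ (by decide +kernel))
    (tb64 _ (by norm_num) _ (by decide +kernel)) h3
  obtain ⟨s1, h1, e1⟩ := st_spec 1 _ _ _ _ _ (tb64 _ (by norm_num) _ (by decide +kernel))
    (tb64 _ (by norm_num) _ (by decide +kernel)) h2
  obtain ⟨s0, h0, e0⟩ := st_spec 0 _ _ _ _ _ (tb64 _ (by norm_num) _ (by decide +kernel))
    (tb64 _ (by norm_num) _ (by decide +kernel)) h1
  refine ⟨s0, h0, ?_⟩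
  have key : ∀ a < 64, (a &&& 2 ^ 0) ||| (a &&& 2 ^ 1) ||| (a &&& 2 ^ 2) ||| (a &&& 2 ^ 3) |||
      (a &&& 2 ^ 4) ||| (a &&& 2 ^ 5) = a := by decide +kernel
  have hk := key a ha
  subst e0 e1 e2 e3 e4 e5
  conv_rhs => rw [← hk]
  simp only [Nat.or_assoc]

def clos (As : List ℕ) (G S : ℕ) : ℕ :=
  Nat.lor G (As.foldl (fun H a => Nat.lor H (un H a)) (Nat.lor (un G S) (Nat.shiftLeft 1 S)))

noncomputable def psum (l : List (ℕ × ℕ)) (G : ℕ) : ℕ :=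
  List.rec (motive := fun _ => ℕ) 0
    (fun x _ ih => Nat.add (Nat.mul x.2 (Nat.land (Nat.shiftRight G x.1) 1)) ih) l

theorem psum_nil (G : ℕ) : psum [] G = 0 := rfl

theorem psum_cons (x : ℕ × ℕ) (t : List (ℕ × ℕ)) (G : ℕ) : psum (x :: t) G =
  Nat.add (Nat.mul x.2 (Nat.land (Nat.shiftRight G x.1) 1)) (psum t G) := rfl

noncomputable def srch (As : List ℕ) (pos L : List (ℕ × ℕ)) : ℕ → ℕ → ℕ → ℕ → ℕ → Bool :=
  List.rec (motive := fun _ => ℕ → ℕ → ℕ → ℕ → ℕ → Bool)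
  (fun _ _ _ d p => Nat.ble d p)
  (fun x _ ih rest G out d p =>
    bif Nat.ble (Nat.add d rest) p then true else
    bif Nat.beq (Nat.land (Nat.shiftRight G x.1) 1) 1 then
      force (Nat.sub rest x.2) fun rest' => force (Nat.add d x.2) fun d' => ih rest' G out d' p
    else
      force (Nat.sub rest x.2) fun rest' =>
      (force (clos As G x.1) fun G2 =>
        bif Nat.beq (Nat.land G2 out) 0 then
          force (psum pos G2) fun p' => force (Nat.add d x.2) fun d' => ih rest' G2 out d' p'
        else true) &&
      (force (Nat.lor out (Nat.shiftLeft 1 x.1)) fun out' => ih rest' G out' d p)) L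

theorem srch_nil (As : List ℕ) (pos : List (ℕ × ℕ)) (rest G out d p : ℕ) :
    srch As pos [] rest G out d p = Nat.ble d p := rfl

theorem srch_cons (As : List ℕ) (pos L : List (ℕ × ℕ)) (x : ℕ × ℕ) (rest G out d p : ℕ) :
    srch As pos (x :: L) rest G out d p =
    (bif Nat.ble (Nat.add d rest) p then true else
    bif Nat.beq (Nat.land (Nat.shiftRight G x.1) 1) 1 then
      force (Nat.sub rest x.2) fun rest' => force (Nat.add d x.2) fun d' => srch As pos L rest' G out d' p
    else
      force (Nat.sub rest x.2) fun rest' =>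
      (force (clos As G x.1) fun G2 =>
        bif Nat.beq (Nat.land G2 out) 0 then
          force (psum pos G2) fun p' => force (Nat.add d x.2) fun d' => srch As pos L rest' G2 out d' p'
        else true) &&
      (force (Nat.lor out (Nat.shiftLeft 1 x.1)) fun out' => srch As pos L rest' G out' d p)) := rfl

section sound
set_option linter.unusedSectionVars false
variable (g : ℕ → Prop) [DecidablePred g]

def gs (l : List (ℕ × ℕ)) : ℕ := (l.map fun x => if g x.1 then x.2 else 0).sum

theorem gs_le (l : List (ℕ × ℕ)) : gs g l ≤ (l.map Prod.snd).sum := by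
  induction l with
  | nil => simp [gs]
  | cons x t ih =>
    simp only [gs, List.map_cons, List.sum_cons] at *
    split_ifs <;> omega

theorem psum_le (l : List (ℕ × ℕ)) (G : ℕ) (hG : ∀ k, G.testBit k = true → g k) :
    psum l G ≤ gs g l := by
  induction l with
  | nil => simp [gs, psum_nil]
  | cons x t ih =>
    simp only [gs, psum_cons, List.map_cons, List.sum_cons] at *
    apply Nat.add_le_add _ ih
    change x.2 * ((G >>> x.1) &&& 1) ≤ _
    rw [Nat.and_one_is_mod, Nat.shiftRight_eq_div_pow, ← Nat.toNat_testBit]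
    cases hb : G.testBit x.1 with
    | false => simp
    | true => simp [hG _ hb]


theorem fold_sub (As : List ℕ)
    (hA : ∀ a ∈ As, a < 64 ∧ ∀ s, g s → g (s ||| a)) (H : ℕ) (hH : ∀ k, H.testBit k = true → g k) :
    ∀ k, (As.foldl (fun H a => Nat.lor H (un H a)) H).testBit k = true → g k := by
  induction As generalizing H with
  | nil => simpa using hH
  | cons a t ih =>
    simp only [List.foldl_cons]
    change ∀ k, (t.foldl _ (H ||| un H a)).testBit k = true → _
    apply ih (fun b hb => hA b (List.mem_cons_of_mem _ hb))
    intro k hk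
    rw [Nat.testBit_or, Bool.or_eq_true] at hk
    rcases hk with hk | hk
    · exact hH k hk
    · have := hA a (List.mem_cons_self)
      obtain ⟨s, hs, rfl⟩ := un_spec _ _ _ this.1 hk
      exact this.2 _ (hH _ hs)

theorem clos_sub (hg : ∀ a b, g a → g b → g (a ||| b)) (As : List ℕ)
    (hA : ∀ a ∈ As, a < 64 ∧ ∀ s, g s → g (s ||| a)) (G S : ℕ) (hS : S < 64) (hgS : g S) (hG : ∀ k, G.testBit k = true → g k) :
    ∀ k, (clos As G S).testBit k = true → g k := by
  intro k hk
  have hk' : (G ||| (As.foldl (fun H a => Nat.lor H (un H a)) (un G S ||| 1 <<< S))).testBit k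
    = true := hk
  clear hk
  rename' hk' => hk
  rw [Nat.testBit_or, Bool.or_eq_true] at hk
  rcases hk with hk | hk
  · exact hG k hk
  · refine fold_sub g As hA _ ?_ k hk
    intro k hk
    rw [Nat.testBit_or, Bool.or_eq_true] at hk
    rcases hk with hk | hk
    · obtain ⟨s, hs, rfl⟩ := un_spec _ _ _ hS hk
      exact hg _ _ (hG _ hs) hgS
    · rw [Nat.one_shiftLeft, Nat.testBit_two_pow] at hk
      simp at hk
      exact hk ▸ hgS

theorem srch_sound (hg : ∀ a b, g a → g b → g (a ||| b)) (As : List ℕ)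
    (hA : ∀ a ∈ As, a < 64 ∧ ∀ s, g s → g (s ||| a)) (pos L : List (ℕ × ℕ)) (rest G out d p : ℕ) (hL : ∀ x ∈ L, x.1 < 64)
    (h : srch As pos L rest G out d p = true)
    (hG : ∀ k, G.testBit k = true → g k) (ho : ∀ k, out.testBit k = true → ¬ g k)
    (hr : rest = (L.map Prod.snd).sum) (hp : p ≤ gs g pos) :
    d + gs g L ≤ gs g pos := by
  induction L generalizing rest G out d p with
  | nil =>
    simp only [srch_nil, Nat.ble_eq] at h
    simp only [gs, List.map_nil, List.sum_nil] at *
    omega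
  | cons x L ih =>
    have ih' := fun rest G out d p => ih rest G out d p (fun y hy => hL y (List.mem_cons_of_mem _ hy))
    have hx := hL x List.mem_cons_self
    have hle := gs_le g (x :: L)
    have hgs : gs g (x :: L) = (if g x.1 then x.2 else 0) + gs g L := by simp [gs]
    have htb : Nat.beq (Nat.land (Nat.shiftRight G x.1) 1) 1 = G.testBit x.1 := by
      have : Nat.land (Nat.shiftRight G x.1) 1 = (G.testBit x.1).toNat := by
        rw [Nat.toNat_testBit, ← Nat.shiftRight_eq_div_pow]
        exact Nat.and_one_is_mod _
      rw [this]
      cases G.testBit x.1 <;> rfl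
    simp only [srch_cons, force_eq, htb] at h
    change (bif Nat.ble (d + rest) p then true else
      bif G.testBit x.1 then srch As pos L (rest - x.2) G out (d + x.2) p else
      (bif Nat.beq (clos As G x.1 &&& out) 0 then
        srch As pos L (rest - x.2) (clos As G x.1) out (d + x.2) (psum pos (clos As G x.1))
      else true) && srch As pos L (rest - x.2) G (out ||| 1 <<< x.1) d p) = true at h
    cases h1 : Nat.ble (d + rest) p with
    | true =>
      rw [Nat.ble_eq] at h1
      omega
    | false =>
      have hr' : rest - x.2 = (L.map Prod.snd).sum := by
        simp only [List.map_cons, List.sum_cons] at hr; omega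
      rw [h1, cond_false] at h
      cases h2 : G.testBit x.1 with
      | true =>
        rw [h2, cond_true] at h
        have := ih' _ _ _ _ _ h hG ho hr' hp
        rw [hgs, if_pos (hG _ h2)]
        omega
      | false =>
        rw [h2, cond_false, Bool.and_eq_true] at h
        by_cases hgx : g x.1
        · have hc := clos_sub g hg As hA G x.1 hx hgx hG
          cases h3 : Nat.beq (clos As G x.1 &&& out) 0 with
          | true =>
            rw [h3, cond_true] at h
            have := ih' _ _ _ _ _ h.1 hc ho hr' (psum_le g pos _ hc)
            rw [hgs, if_pos hgx]
            omega
          | false =>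
            exfalso
            have hne : clos As G x.1 &&& out ≠ 0 := by
              intro h0; rw [h0] at h3; exact absurd h3 (by decide)
            obtain ⟨k, hk⟩ := Nat.exists_testBit_of_ne_zero hne
            rw [Nat.testBit_and, Bool.and_eq_true] at hk
            exact ho k hk.2 (hc k hk.1)
        · have ho' : ∀ k, (out ||| 1 <<< x.1).testBit k = true → ¬ g k := by
            intro k hk
            rw [Nat.testBit_or, Bool.or_eq_true] at hk
            rcases hk with hk | hk
            · exact ho k hk
            · rw [Nat.one_shiftLeft, Nat.testBit_two_pow] at hk
              simp at hk
              exact hk ▸ hgx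
          have := ih' _ _ _ _ _ h.2 hG ho' hr' hp
          rw [hgs, if_neg hgx]
          omega
end sound

def dot : List ℕ → ℕ → ℕ
  | [], _ => 0
  | w :: ws, m => w * (m % 2) + dot ws (m / 2)

def ord : List ℕ := [0, 1, 2, 4, 8, 16, 32, 3, 5, 6, 9, 10, 12, 17, 18, 20, 24, 33, 34, 36, 40, 48, 7, 11, 13, 14, 19, 21, 22, 25, 26, 28, 35, 37, 38, 41, 42, 44, 49, 50, 52, 56, 15, 23, 27, 29, 30, 39, 43, 45, 46, 51, 53, 54, 57, 58, 60, 31, 47, 55, 59, 61, 62, 63]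

def posL (ws o : List ℕ) : List (ℕ × ℕ) :=
  (o.map fun m => (m, 2 * dot ws m - ws.sum)).filter fun x => !Nat.beq x.2 0

def negL (ws o : List ℕ) : List (ℕ × ℕ) :=
  (o.map fun m => (m, ws.sum - 2 * dot ws m)).filter fun x => !Nat.beq x.2 0

noncomputable def check (n : ℕ) (ws As : List ℕ) : Bool :=
  forceL (posL ws (ord.filter fun m => Nat.blt m (2 ^ n))) fun pos =>
  forceL (negL ws (ord.filter fun m => Nat.blt m (2 ^ n))) fun neg =>
  force ((neg.map Prod.snd).sum) fun rest =>
  srch As pos neg rest 0 0 0 0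

theorem share_list (g : ℕ → Prop) [DecidablePred g] (ws o : List ℕ) :
    (o.map fun m => if g m then (2 * (dot ws m : ℤ) - (ws.sum : ℤ)) else 0).sum
      = (gs g (posL ws o) : ℤ) - gs g (negL ws o) := by
  induction o with
  | nil => simp [gs, posL, negL]
  | cons m t ih =>
    rw [List.map_cons, List.sum_cons, ih]
    have hp : gs g (posL ws (m :: t)) = (if g m then 2 * dot ws m - ws.sum else 0) + gs g (posL ws t) := by
      simp only [posL, List.map_cons, List.filter_cons]
      split_ifs with h1 h2 h2 <;> simp_all [gs]
    have hn : gs g (negL ws (m :: t)) = (if g m then ws.sum - 2 * dot ws m else 0) + gs g (negL ws t) := by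
      simp only [negL, List.map_cons, List.filter_cons]
      split_ifs with h1 h2 h2 <;> simp_all [gs]
    rw [hp, hn]
    generalize ws.sum = W
    split_ifs <;> omega

theorem ord_perm (n : ℕ) (hn : n ≤ 6) :
    (ord.filter fun m => Nat.blt m (2 ^ n)).Perm (List.range (2 ^ n)) := by
  revert n
  decide +kernel

theorem check_sound (n : ℕ) (hn : n ≤ 6) (ws As : List ℕ) (h : check n ws As = true)
    (g : ℕ → Prop) [DecidablePred g] (hg : ∀ a b, g a → g b → g (a ||| b))
    (hA : ∀ a ∈ As, a < 64 ∧ ∀ s, g s → g (s ||| a)) :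
    0 ≤ ∑ m ∈ Finset.range (2 ^ n), if g m then (2 * (dot ws m : ℤ) - (ws.sum : ℤ)) else 0 := by
  have e : ∑ m ∈ Finset.range (2 ^ n), (if g m then (2 * (dot ws m : ℤ) - (ws.sum : ℤ)) else 0) =
      ((List.range (2 ^ n)).map
        fun m => if g m then (2 * (dot ws m : ℤ) - (ws.sum : ℤ)) else 0).sum := by
    rfl
  rw [e, ← ((ord_perm n hn).map _).sum_eq, share_list]
  simp only [check, forceL_eq, force_eq] at h
  have := srch_sound g hg As hA _ _ _ _ _ _ _ ?_ h (by simp) (by simp) rfl (by simp)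
  · omega
  · intro x hx
    simp only [negL, List.mem_filter, List.mem_map] at hx
    obtain ⟨⟨m, ⟨hm, -⟩, rfl⟩, -⟩ := hx
    have : ∀ m ∈ ord, m < 64 := by decide +kernel
    exact this m hm

theorem dot_eq (ws : List ℕ) (m : ℕ) :
    dot ws m = ∑ i : Fin ws.length, ws.get i * (m.testBit i).toNat := by
  induction ws generalizing m with
  | nil => simp [dot]
  | cons w t ih =>
    rw [dot, ih]
    simp only [List.length_cons, Fin.sum_univ_succ, List.get_cons_zero,
      Fin.val_zero, Fin.val_succ, Nat.testBit_succ]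
    congr 2
    rw [Nat.toNat_testBit]; simp

theorem sum_eq (ws : List ℕ) : ws.sum = ∑ i : Fin ws.length, ws.get i := by
  induction ws with
  | nil => simp
  | cons w t ih =>
    simp only [List.length_cons, Fin.sum_univ_succ, List.get_cons_zero, List.sum_cons, ih]
    rfl

/-- The set coded by a bit mask. -/
def dec {n : ℕ} (p : Fin n → α) (m : ℕ) : Finset α :=
  (univ.filter fun i : Fin n => m.testBit i = true).image p

theorem mem_dec {n : ℕ} {p : Fin n → α} (hp : Function.Injective p) (m : ℕ) (i : Fin n) :
    p i ∈ dec p m ↔ m.testBit i = true := by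
  simp only [dec, mem_image, mem_filter, mem_univ, true_and]
  constructor
  · rintro ⟨j, hj, e⟩
    exact hp e ▸ hj
  · intro h
    exact ⟨i, h, rfl⟩

theorem dec_or {n : ℕ} (p : Fin n → α) (a b : ℕ) : dec p (a ||| b) = dec p a ∪ dec p b := by
  simp only [dec, Nat.testBit_or, Bool.or_eq_true, filter_or, image_union]

theorem dec_inj {n : ℕ} {p : Fin n → α} (hp : Function.Injective p) {a b : ℕ}
    (ha : a < 2 ^ n) (hb : b < 2 ^ n) (h : dec p a = dec p b) : a = b := by
  apply Nat.eq_of_testBit_eq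
  intro i
  by_cases hi : i < n
  · have := mem_dec hp a ⟨i, hi⟩
    rw [h, mem_dec hp] at this
    simp only at this
    exact Bool.eq_iff_iff.2 this.symm
  · have hle : 2 ^ n ≤ 2 ^ i := Nat.pow_le_pow_right (by norm_num) (by omega)
    rw [Nat.testBit_lt_two_pow (by omega), Nat.testBit_lt_two_pow (by omega)]

theorem dec_surj {n : ℕ} {p : Fin n → α} (hp : Function.Injective p) :
    (range (2 ^ n)).image (dec p) = (univ.image p).powerset := by
  apply Finset.eq_of_subset_of_card_le
  · intro S hS
    obtain ⟨m, _, rfl⟩ := mem_image.1 hS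
    rw [mem_powerset]
    exact image_subset_image (filter_subset _ _)
  · rw [card_powerset, card_image_of_injective _ hp, card_image_of_injOn]
    · simp
    · intro a ha b hb h
      exact dec_inj hp (by simpa using ha) (by simpa using hb) h

theorem share_frankl (F : Finset (Finset α)) (huc : unionClosed F) (ws As : List ℕ)
    (hn : ws.length ≤ 6) (hpos : 0 < ws.length) (hw : ∀ w ∈ ws, 0 < w)
    (p : Fin ws.length → α) (hp : Function.Injective p) (hU : ∀ i, p i ∈ famUnion F)
    (hA : ∀ a ∈ As, a < 64 ∧ dec p a ∈ F) (hch : check ws.length ws As = true) : frankl F := by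
  by_contra hF
  have hlt : ∀ i, 2 * cnt (p i) F < F.card := by
    intro i
    by_contra hge
    exact hF ⟨p i, hU i, by omega⟩
  let f : Finset α → ℤ := fun A => ∑ i, (ws.get i : ℤ) * (2 * (if p i ∈ A then 1 else 0) - 1)
  have h1 : ∑ A ∈ F, f A = ∑ i, (ws.get i : ℤ) * (2 * cnt (p i) F - F.card) := by
    simp only [f]
    rw [sum_comm]
    refine sum_congr rfl fun i _ => ?_
    rw [← mul_sum, sum_sub_distrib, ← mul_sum, cnt]
    simp
  have h2 : ∑ A ∈ F, f A < 0 := by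
    rw [h1]
    apply sum_neg
    · intro i _
      apply mul_neg_of_pos_of_neg
      · exact_mod_cast hw _ (List.get_mem _ _)
      · have := hlt i
        omega
    · exact ⟨⟨0, hpos⟩, mem_univ _⟩
  let X := univ.image p
  have h3 : ∑ A ∈ F, f A = ∑ K ∈ F.image (· \ X), ∑ A ∈ F with A \ X = K, f A :=
    (sum_fiberwise_of_maps_to (fun A hA => mem_image_of_mem _ hA) f).symm
  have h4 : ∀ K ∈ F.image (· \ X), 0 ≤ ∑ A ∈ F with A \ X = K, f A := by
    intro K hK
    have hKX : Disjoint K X := by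
      obtain ⟨A, _, rfl⟩ := mem_image.1 hK
      exact sdiff_disjoint
    have hdX : ∀ m, dec p m ⊆ X := fun m => image_subset_image (filter_subset _ _)
    have hfil : (F.filter fun A => A \ X = K) =
        ((range (2 ^ ws.length)).filter fun m => K ∪ dec p m ∈ F).image fun m => K ∪ dec p m := by
      ext A
      simp only [mem_filter, mem_image, mem_range]
      constructor
      · rintro ⟨hA, rfl⟩
        have : A ∩ X ∈ (range (2 ^ ws.length)).image (dec p) := by
          rw [dec_surj hp, mem_powerset]; exact inter_subset_right
        obtain ⟨m, hm, e⟩ := mem_image.1 this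
        have e2 : A \ X ∪ dec p m = A := by rw [e]; exact sdiff_union_inter A X
        exact ⟨m, ⟨by simpa using hm, by rw [e2]; exact hA⟩, e2⟩
      · rintro ⟨m, ⟨_, hm⟩, rfl⟩
        refine ⟨hm, ?_⟩
        rw [union_sdiff_distrib, sdiff_eq_self_of_disjoint hKX, sdiff_eq_empty_iff_subset.2 (hdX m),
          union_empty]
    have hinj : Set.InjOn (fun m => K ∪ dec p m)
        ((range (2 ^ ws.length)).filter fun m => K ∪ dec p m ∈ F) := by
      intro a ha b hb h
      simp only [coe_filter, mem_range, Set.mem_ofPred_eq] at ha hb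
      apply dec_inj hp ha.1 hb.1
      have := congrArg (· ∩ X) h
      simpa [union_inter_distrib_right, disjoint_iff_inter_eq_empty.1 hKX,
        inter_eq_left.2 (hdX _)] using this
    rw [hfil, sum_image hinj, sum_filter]
    have hfm : ∀ m, f (K ∪ dec p m) = 2 * (dot ws m : ℤ) - (ws.sum : ℤ) := by
      intro m
      rw [dot_eq, sum_eq]
      push_cast
      rw [mul_sum, ← sum_sub_distrib]
      refine sum_congr rfl fun i _ => ?_
      have hi : p i ∉ K := fun hk =>
        disjoint_left.1 hKX hk (mem_image_of_mem _ (mem_univ _))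
      have : p i ∈ K ∪ dec p m ↔ m.testBit i = true := by
        rw [mem_union, mem_dec hp]; simp [hi]
      simp only [this]
      cases m.testBit i <;> simp; ring
    simp only [hfm]
    refine check_sound ws.length hn ws As hch (fun m => K ∪ dec p m ∈ F) ?_ ?_
    · intro a b ha hb
      have := huc _ ha _ hb
      rwa [dec_or, union_union_distrib_left]
    · intro a ha
      refine ⟨(hA a ha).1, fun s hs => ?_⟩
      have := huc _ hs _ (hA a ha).2
      rwa [dec_or, ← union_assoc]
  have h5 := sum_nonneg h4
  rw [← h3] at h5
  omega

def row : List ℕ → ℕ → ℕ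
  | [], _ => 0
  | q :: t, j => (q.testBit j).toNat + 2 * row t j

theorem row_lt (l : List ℕ) (j : ℕ) : row l j < 2 ^ l.length := by
  induction l with
  | nil => simp [row]
  | cons q t ih =>
    simp only [row, List.length_cons, pow_succ]
    have := Bool.toNat_lt (q.testBit j)
    omega

theorem row_testBit (l : List ℕ) (j : ℕ) (i : ℕ) (hi : i < l.length) :
    (row l j).testBit i = (l[i]).testBit j := by
  induction l generalizing i with
  | nil => simp at hi
  | cons q t ih =>
    have hq := Bool.toNat_lt (q.testBit j)
    cases i with
    | zero =>
      simp only [row, Nat.testBit_zero, List.getElem_cons_zero]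
      cases q.testBit j <;> simp
    | succ i =>
      rw [Nat.testBit_succ]
      have : row (q :: t) j / 2 = row t j := by simp only [row]; omega
      rw [this, List.getElem_cons_succ]
      exact ih i _

noncomputable def test (r : ℕ) (wts : List ℕ → List ℕ) (l : List ℕ) : Bool :=
  !((List.range r).all (fun j => Nat.beq (l.countP fun q => q.testBit j) 3) &&
    (List.range r).all (fun j => (List.range r).all fun k =>
      Nat.beq j k || !Nat.beq (row l j) (row l k))) ||
  check l.length (wts l) ((List.range r).map (row l))

def pre (r : ℕ) (l : List ℕ) : Bool :=
  (List.range r).all fun j => Nat.ble (l.countP fun q => q.testBit j) 3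

noncomputable def allL (r : ℕ) (ok : ℕ → Bool) (tst : List ℕ → Bool) : ℕ → ℕ → List ℕ → Bool
  | 0, _, acc => tst acc
  | n + 1, lo, acc => (List.range (2 ^ r)).all fun q =>
      Nat.blt q lo || !ok q || !pre r (acc ++ [q]) || allL r ok tst n q (acc ++ [q])

theorem allL_sound (r : ℕ) (ok : ℕ → Bool) (tst : List ℕ → Bool) (n lo : ℕ) (acc : List ℕ)
    (h : allL r ok tst n lo acc = true) (l : List ℕ) (hl : l.length = n)
    (hs : (lo :: l).Pairwise (· ≤ ·)) (hok : ∀ q ∈ l, q < 2 ^ r ∧ ok q = true)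
    (hpre : ∀ l', l' <+: acc ++ l → pre r l' = true) :
    tst (acc ++ l) = true := by
  induction n generalizing lo acc l with
  | zero =>
    rw [List.length_eq_zero_iff] at hl
    subst hl
    simpa [allL] using h
  | succ n ih =>
    cases l with
    | nil => simp at hl
    | cons q t =>
      simp only [allL, List.all_eq_true, List.mem_range] at h
      have hq := hok q List.mem_cons_self
      have h' := h q hq.1
      rw [List.pairwise_cons] at hs
      have hle := hs.1 q List.mem_cons_self
      have hb : Nat.blt q lo = false := by
        rw [← Bool.not_eq_true]; simp only [Nat.blt_eq]; omega
      have e : acc ++ q :: t = acc ++ [q] ++ t := by simp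
      rw [e] at hpre ⊢
      rw [hb, hq.2, hpre _ (List.prefix_append _ _)] at h'
      have := ih q (acc ++ [q]) (by simpa using h') t (by simpa using hl) hs.2
        (fun x hx => hok x (List.mem_cons_of_mem _ hx)) hpre
      exact this

def wts3 (l : List ℕ) : List ℕ :=
  l.map fun q =>
    bif Nat.beq q 7 then
      (bif l.any (fun x => Nat.beq x 3 || Nat.beq x 5 || Nat.beq x 6) then 5 else 3)
    else bif Nat.beq q 3 || Nat.beq q 5 || Nat.beq q 6 then 4 else 2

def wts4 (l : List ℕ) : List ℕ := l.map fun _ => 1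

def ok3 (q : ℕ) : Bool := !Nat.beq q 0
def ok4 (q : ℕ) : Bool :=
  !(Nat.beq q 0 || Nat.beq q 1 || Nat.beq q 2 || Nat.beq q 4 || Nat.beq q 8)

theorem all3 : ∀ n < 6, allL 3 ok3 (test 3 wts3) n 0 [] = true := by decide +kernel

theorem all4 : allL 4 ok4 (test 4 wts4) 6 0 [] = true := by decide +kernel

def pat (r : ℕ) (A : ℕ → Finset α) (x : α) : ℕ := Nat.ofBits fun j : Fin r => decide (x ∈ A j)

theorem pat_testBit (r : ℕ) (A : ℕ → Finset α) (x : α) (j : ℕ) (hj : j < r) :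
    (pat r A x).testBit j = decide (x ∈ A j) := by
  rw [pat, Nat.testBit_ofBits_lt _ _ hj]

theorem generic (F : Finset (Finset α)) (huc : unionClosed F) (r : ℕ) (A : ℕ → Finset α)
    (hAF : ∀ j < r, A j ∈ F) (hA3 : ∀ j < r, (A j).card = 3)
    (hne : ∀ j < r, ∀ k < r, j ≠ k → A j ≠ A k) (X : Finset α)
    (hX : ∀ j < r, A j ⊆ X) (hXU : X ⊆ famUnion F) (hX0 : 0 < X.card) (hX6 : X.card ≤ 6)
    (ok : ℕ → Bool) (hok : ∀ x ∈ X, ok (pat r A x) = true)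
    (wts : List ℕ → List ℕ) (hwl : ∀ l, (wts l).length = l.length)
    (hw0 : ∀ l, ∀ w ∈ wts l, 0 < w)
    (hall : allL r ok (test r wts) X.card 0 [] = true) : frankl F := by
  obtain ⟨L, hLp, hLs⟩ : ∃ L : List α, L.Perm X.toList ∧
      (L.map (pat r A)).Pairwise (· ≤ ·) := by
    refine ⟨X.toList.insertionSort (fun x y => pat r A x ≤ pat r A y),
      List.perm_insertionSort _ _, ?_⟩
    rw [List.pairwise_map]
    have : Std.Total (fun x y => pat r A x ≤ pat r A y) := ⟨fun x y => le_total _ _⟩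
    have : IsTrans α (fun x y => pat r A x ≤ pat r A y) := ⟨fun x y z => le_trans⟩
    exact List.pairwise_insertionSort _ _
  have hnd : L.Nodup := hLp.nodup_iff.2 X.nodup_toList
  have hmem : ∀ x, x ∈ L ↔ x ∈ X := fun x => by rw [hLp.mem_iff, mem_toList]
  have hlen : L.length = X.card := by rw [hLp.length_eq, length_toList]
  set l := L.map (pat r A) with hl
  have hll : l.length = L.length := by simp [hl]
  have hwlen : (wts l).length = L.length := by rw [hwl, hll]
  have hcount : ∀ j < r, (l.countP fun q => q.testBit j) = 3 := by
    intro j hj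
    rw [← hA3 j hj, hl, List.countP_map]
    have : A j = (L.filter fun x => decide (x ∈ A j)).toFinset := by
      ext x
      simp only [List.mem_toFinset, List.mem_filter, hmem, decide_eq_true_eq]
      exact ⟨fun h => ⟨hX j hj h, h⟩, fun h => h.2⟩
    conv_rhs => rw [this, List.toFinset_card_of_nodup (hnd.filter _)]
    rw [List.countP_eq_length_filter]
    congr 2
    funext x
    simp [pat_testBit r A x j hj]
  have htest := allL_sound r ok _ _ _ _ hall l (by omega)
    (List.pairwise_cons.2 ⟨fun _ _ => Nat.zero_le _, hLs⟩) (by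
      intro q hq
      obtain ⟨x, hx, rfl⟩ := List.mem_map.1 hq
      exact ⟨Nat.ofBits_lt_two_pow _, hok x ((hmem x).1 hx)⟩) (by
      intro l' hl'
      simp only [pre, List.all_eq_true, List.mem_range, Nat.ble_eq]
      intro j hj
      rw [← hcount j hj]
      exact hl'.sublist.countP_le)
  let p : Fin (wts l).length → α := fun i => L.get (i.cast hwlen)
  have hp : Function.Injective p := by
    intro i j h
    have := hnd.injective_get h
    simpa [Fin.ext_iff] using this
  have hpX : ∀ i, p i ∈ X := fun i => (hmem _).1 (List.get_mem _ _)
  have hbit : ∀ j < r, ∀ i : Fin (wts l).length, (row l j).testBit i = decide (p i ∈ A j) := by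
    intro j hj i
    rw [row_testBit l j i (by have := i.2; omega), ← pat_testBit r A _ j hj]
    simp [hl, p]
  have hdec : ∀ j < r, dec p (row l j) = A j := by
    intro j hj
    ext x
    simp only [dec, mem_image, mem_filter, mem_univ, true_and]
    constructor
    · rintro ⟨i, hi, rfl⟩
      rw [hbit j hj] at hi
      simpa using hi
    · intro hx
      obtain ⟨i, hi⟩ := List.get_of_mem ((hmem x).2 (hX j hj hx))
      have e : p (i.cast hwlen.symm) = x := by simpa [p] using hi
      refine ⟨i.cast hwlen.symm, ?_, e⟩
      rw [hbit j hj, e]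
      simpa using hx
  have hcheck : check l.length (wts l) ((List.range r).map (row l)) = true := by
    simp only [List.nil_append, test, Bool.or_eq_true, Bool.not_eq_true'] at htest
    rcases htest with h | h
    · exfalso
      rw [← Bool.not_eq_true] at h
      apply h
      rw [Bool.and_eq_true]
      simp only [List.all_eq_true, List.mem_range, Nat.beq_eq, Bool.or_eq_true]
      constructor
      · exact hcount
      · intro j hj k hk
        by_cases hjk : j = k
        · exact Or.inl hjk
        · right
          rw [Bool.not_eq_true', ← Bool.not_eq_true, Nat.beq_eq]
          intro e
          apply hne j hj k hk hjk
          rw [← hdec j hj, ← hdec k hk, e]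
    · exact h
  refine share_frankl F huc (wts l) ((List.range r).map (row l)) (by omega) (by omega) (hw0 l) p hp
    (fun i => hXU (hpX i)) ?_ ?_
  · intro a ha
    obtain ⟨j, hj, rfl⟩ := List.mem_map.1 ha
    rw [List.mem_range] at hj
    refine ⟨?_, by rw [hdec j hj]; exact hAF j hj⟩
    have h1 := row_lt l j
    have h2 : 2 ^ l.length ≤ 2 ^ 6 := Nat.pow_le_pow_right (by norm_num) (by omega)
    omega
  · rw [hwl]; exact hcheck

theorem three (F : Finset (Finset α)) (huc : unionClosed F) (B₁ B₂ B₃ : Finset α)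
    (h₁ : B₁ ∈ F) (h₂ : B₂ ∈ F) (h₃ : B₃ ∈ F)
    (n₁₂ : B₁ ≠ B₂) (n₁₃ : B₁ ≠ B₃) (n₂₃ : B₂ ≠ B₃)
    (c₁ : B₁.card = 3) (c₂ : B₂.card = 3) (c₃ : B₃.card = 3)
    (hu : (B₁ ∪ B₂ ∪ B₃).card < 6) : frankl F := by
  let A : ℕ → Finset α := fun j => if j = 0 then B₁ else if j = 1 then B₂ else B₃
  have hsub : ∀ B ∈ F, B ⊆ famUnion F := fun B hB => le_sup (f := id) hB
  have hc := card_le_card (show B₁ ⊆ B₁ ∪ B₂ ∪ B₃ by intro x; simp; tauto)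
  refine generic F huc 3 A ?_ ?_ ?_ (B₁ ∪ B₂ ∪ B₃) ?_ ?_ (by omega) (by omega) ok3 ?_ wts3 ?_ ?_
    (all3 _ hu)
  · intro j hj; interval_cases j <;> simpa [A]
  · intro j hj; interval_cases j <;> simpa [A]
  · intro j hj k hk hjk
    interval_cases j <;> interval_cases k <;> simp_all [A, Ne.symm]
  · intro j hj x; interval_cases j <;> simp [A] <;> tauto
  · exact union_subset (union_subset (hsub _ h₁) (hsub _ h₂)) (hsub _ h₃)
  · intro x hx
    simp only [ok3, Bool.not_eq_true', ← Bool.not_eq_true, Nat.beq_eq]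
    intro h0
    have t0 := pat_testBit 3 A x 0 (by norm_num)
    have t1 := pat_testBit 3 A x 1 (by norm_num)
    have t2 := pat_testBit 3 A x 2 (by norm_num)
    rw [h0] at t0 t1 t2
    simp [A] at t0 t1 t2
    simp [t0, t1, t2] at hx
  · intro l; simp [wts3]
  · intro l w hw
    simp only [wts3, List.mem_map] at hw
    obtain ⟨q, _, rfl⟩ := hw
    simp only [cond_eq_ite]
    split_ifs <;> norm_num

theorem ok4_spec : ∀ q < 2 ^ 4,
    (q.testBit 1 = true ∨ q.testBit 2 = true ∨ q.testBit 3 = true) →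
    (q.testBit 0 = true ∨ q.testBit 2 = true ∨ q.testBit 3 = true) →
    (q.testBit 0 = true ∨ q.testBit 1 = true ∨ q.testBit 3 = true) →
    (q.testBit 0 = true ∨ q.testBit 1 = true ∨ q.testBit 2 = true) → ok4 q = true := by
  intro q hq
  interval_cases q <;> decide

theorem four (F : Finset (Finset α)) (huc : unionClosed F) (B₁ B₂ B₃ B₄ : Finset α)
    (h₁ : B₁ ∈ F) (h₂ : B₂ ∈ F) (h₃ : B₃ ∈ F) (h₄ : B₄ ∈ F)
    (n₁₂ : B₁ ≠ B₂) (n₁₃ : B₁ ≠ B₃) (n₁₄ : B₁ ≠ B₄)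
    (n₂₃ : B₂ ≠ B₃) (n₂₄ : B₂ ≠ B₄) (n₃₄ : B₃ ≠ B₄)
    (c₁ : B₁.card = 3) (c₂ : B₂.card = 3) (c₃ : B₃.card = 3) (c₄ : B₄.card = 3)
    (hu : (B₁ ∪ B₂ ∪ B₃ ∪ B₄).card ≤ 6) : frankl F := by
  by_cases u₁ : (B₂ ∪ B₃ ∪ B₄).card < 6
  · exact three F huc B₂ B₃ B₄ h₂ h₃ h₄ n₂₃ n₂₄ n₃₄ c₂ c₃ c₄ u₁
  by_cases u₂ : (B₁ ∪ B₃ ∪ B₄).card < 6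
  · exact three F huc B₁ B₃ B₄ h₁ h₃ h₄ n₁₃ n₁₄ n₃₄ c₁ c₃ c₄ u₂
  by_cases u₃ : (B₁ ∪ B₂ ∪ B₄).card < 6
  · exact three F huc B₁ B₂ B₄ h₁ h₂ h₄ n₁₂ n₁₄ n₂₄ c₁ c₂ c₄ u₃
  by_cases u₄ : (B₁ ∪ B₂ ∪ B₃).card < 6
  · exact three F huc B₁ B₂ B₃ h₁ h₂ h₃ n₁₂ n₁₃ n₂₃ c₁ c₂ c₃ u₄
  have key : ∀ Y : Finset α, Y ⊆ B₁ ∪ B₂ ∪ B₃ ∪ B₄ → ¬ Y.card < 6 → Y = B₁ ∪ B₂ ∪ B₃ ∪ B₄ :=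
    fun Y hY hc => eq_of_subset_of_card_le hY (by omega)
  have e₁ := key (B₂ ∪ B₃ ∪ B₄) (by intro x; simp only [mem_union]; tauto) u₁
  have e₂ := key (B₁ ∪ B₃ ∪ B₄) (by intro x; simp only [mem_union]; tauto) u₂
  have e₃ := key (B₁ ∪ B₂ ∪ B₄) (by intro x; simp only [mem_union]; tauto) u₃
  have e₄ := key (B₁ ∪ B₂ ∪ B₃) (by intro x; simp only [mem_union]; tauto) u₄
  let A : ℕ → Finset α := fun j => if j = 0 then B₁ else if j = 1 then B₂ else
    if j = 2 then B₃ else B₄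
  have hsub : ∀ B ∈ F, B ⊆ famUnion F := fun B hB => le_sup (f := id) hB
  have hX6 : (B₁ ∪ B₂ ∪ B₃ ∪ B₄).card = 6 := by rw [e₁] at u₁; omega
  refine generic F huc 4 A ?_ ?_ ?_ (B₁ ∪ B₂ ∪ B₃ ∪ B₄) ?_ ?_ (by omega) (by omega) ok4 ?_ wts4 ?_ ?_
    (by rw [hX6]; exact all4)
  · intro j hj; interval_cases j <;> simpa [A]
  · intro j hj; interval_cases j <;> simpa [A]
  · intro j hj k hk hjk
    interval_cases j <;> interval_cases k <;>
      first
        | exact absurd rfl hjk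
        | exact n₁₂
        | exact n₁₃
        | exact n₁₄
        | exact n₂₃
        | exact n₂₄
        | exact n₃₄
        | exact n₁₂.symm
        | exact n₁₃.symm
        | exact n₁₄.symm
        | exact n₂₃.symm
        | exact n₂₄.symm
        | exact n₃₄.symm
  · intro j hj x hx
    simp only [mem_union]
    interval_cases j
    · exact Or.inl (Or.inl (Or.inl hx))
    · exact Or.inl (Or.inl (Or.inr hx))
    · exact Or.inl (Or.inr hx)
    · exact Or.inr hx
  · exact union_subset (union_subset (union_subset (hsub _ h₁) (hsub _ h₂)) (hsub _ h₃)) (hsub _ h₄)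
  · intro x hx
    have m₁ := hx
    have m₂ := hx
    have m₃ := hx
    have m₄ := hx
    rw [← e₁] at m₁
    rw [← e₂] at m₂
    rw [← e₃] at m₃
    rw [← e₄] at m₄
    simp only [mem_union] at m₁ m₂ m₃ m₄
    have t0 : (pat 4 A x).testBit 0 = decide (x ∈ B₁) := pat_testBit 4 A x 0 (by norm_num)
    have t1 : (pat 4 A x).testBit 1 = decide (x ∈ B₂) := pat_testBit 4 A x 1 (by norm_num)
    have t2 : (pat 4 A x).testBit 2 = decide (x ∈ B₃) := pat_testBit 4 A x 2 (by norm_num)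
    have t3 : (pat 4 A x).testBit 3 = decide (x ∈ B₄) := pat_testBit 4 A x 3 (by norm_num)
    have hq := ok4_spec (pat 4 A x) (Nat.ofBits_lt_two_pow _)
    rw [t0, t1, t2, t3] at hq
    simp only [decide_eq_true_eq] at hq
    exact hq (or_assoc.1 m₁) (or_assoc.1 m₂) (or_assoc.1 m₃) (or_assoc.1 m₄)
  · intro l; simp [wts4]
  · intro l w hw
    simp only [wts4, List.mem_map] at hw
    obtain ⟨q, _, rfl⟩ := hw
    norm_num

end FC

theorem uniform_634_fc_family {α : Type*} [DecidableEq α] (F : Finset (Finset α))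
    (huc : unionClosed F) (A₁ A₂ A₃ A₄ : Finset α)
    (h₁ : A₁ ∈ F) (h₂ : A₂ ∈ F) (h₃ : A₃ ∈ F) (h₄ : A₄ ∈ F)
    (hne₁₂ : A₁ ≠ A₂) (hne₁₃ : A₁ ≠ A₃) (hne₁₄ : A₁ ≠ A₄)
    (hne₂₃ : A₂ ≠ A₃) (hne₂₄ : A₂ ≠ A₄) (hne₃₄ : A₃ ≠ A₄)
    (hc₁ : A₁.card = 3) (hc₂ : A₂.card = 3) (hc₃ : A₃.card = 3) (hc₄ : A₄.card = 3)
    (hu : (A₁ ∪ A₂ ∪ A₃ ∪ A₄).card ≤ 6) :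
    frankl F := by
  exact FC.four F huc A₁ A₂ A₃ A₄ h₁ h₂ h₃ h₄ hne₁₂ hne₁₃ hne₁₄ hne₂₃ hne₂₄ hne₃₄ hc₁ hc₂ hc₃ hc₄ hu
end
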